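/- arXiv:1602.06776 — 8 statements merged into one kernel-verified Lean document; each statement's English description precedes it below -/
import Mathlib

section
/- Classification of real Clifford algebras: for all natural numbers p and q, the real Clifford algebra C(p,q) is isomorphic as a ring (equivalently, as an ℝ-algebra) to: the matrix algebra Mat(2^{(p+q)/2}, ℝ) if p − q ≡ 0 or 2 (mod 8); the product Mat(2^{(p+q−1)/2}, ℝ) × Mat(2^{(p+q−1)/2}, ℝ) if p − q ≡ 1 (mod 8); the matrix algebra Mat(2^{(p+q−1)/2}, ℂ) if p − q ≡ 3 or 7 (mod 8); the matrix algebra Mat(2^{(p+q−2)/2}, ℍ) over the quaternions if p − q ≡ 4 or 6 (mod 8); and the product Mat(2^{(p+q−3)/2}, ℍ) × Mat(2^{(p+q−3)/2}, ℍ) if p − q ≡ 5 (mod 8). -/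
/-- The quadratic form `Q_{p,q}` on `ℝ^(p+q)`:
`Q_{p,q}(x) = ∑_{i<p} x_i² − ∑_{p≤i<p+q} x_i²`. -/
noncomputable def Qpq (p q : ℕ) : QuadraticForm ℝ (Fin (p + q) → ℝ) :=
  QuadraticMap.weightedSumSquares ℝ (fun i : Fin (p + q) => if (i : ℕ) < p then (1 : ℝ) else -1)

/-- The real Clifford algebra `C(p,q)`. -/
noncomputable abbrev RealCliffordAlgebra (p q : ℕ) := CliffordAlgebra (Qpq p q)

/-- The algebra of `k × k` matrices over `R`. -/
abbrev Mat (k : ℕ) (R : Type*) [Semiring R] := Matrix (Fin k) (Fin k) R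


namespace CliffClass

set_option linter.unusedSimpArgs false

/-- `A` is generated by anticommuting elements with squares `s i`, and has the right dimension. -/
def Mod (ι : Type) [Fintype ι] (s : ι → ℝ) (A : Type) [Ring A] [Algebra ℝ A] : Prop :=
  ∃ e : ι → A, (∀ i, e i * e i = algebraMap ℝ A (s i)) ∧
    (∀ i j, i ≠ j → e i * e j = -(e j * e i)) ∧
    Algebra.adjoin ℝ (Set.range e) = ⊤ ∧ Module.finrank ℝ A = 2 ^ Fintype.card ι

theorem Mod.reindex {ι κ : Type} [Fintype ι] [Fintype κ] {s : ι → ℝ} {t : κ → ℝ}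
    {A : Type} [Ring A] [Algebra ℝ A] (h : Mod ι s A) (f : κ ≃ ι) (hf : ∀ k, s (f k) = t k) :
    Mod κ t A := by
  obtain ⟨e, h1, h2, h3, h4⟩ := h
  refine ⟨e ∘ f, fun i => ?_, fun i j hij => h2 _ _ (f.injective.ne hij), ?_, ?_⟩
  · simp [h1, hf]
  · rw [f.surjective.range_comp, h3]
  · rw [h4, Fintype.card_congr f]

theorem Mod.map {ι : Type} [Fintype ι] {s : ι → ℝ}
    {A B : Type} [Ring A] [Algebra ℝ A] [Ring B] [Algebra ℝ B] (h : Mod ι s A) (f : A ≃ₐ[ℝ] B) :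
    Mod ι s B := by
  obtain ⟨e, h1, h2, h3, h4⟩ := h
  refine ⟨f ∘ e, fun i => ?_, fun i j hij => ?_, ?_, ?_⟩
  · simp [← map_mul, h1]
  · simp [← map_mul, h2 i j hij]
  · rw [Set.range_comp]
    have := AlgHom.map_adjoin (f : A →ₐ[ℝ] B) (Set.range e)
    rw [h3] at this
    refine this.symm.trans ?_
    rw [Algebra.map_top]
    exact (AlgHom.range_eq_top _).2 f.surjective
  · rw [← h4, f.toLinearEquiv.finrank_eq]

theorem finrank_cliff (n : ℕ) (Q : QuadraticForm ℝ (Fin n → ℝ)) :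
    Module.Finite ℝ (CliffordAlgebra Q) ∧ Module.finrank ℝ (CliffordAlgebra Q) = 2 ^ n := by
  have : Invertible (2 : ℝ) := invertibleOfNonzero two_ne_zero
  let b := ((Pi.basisFun ℝ (Fin n)).ExteriorAlgebra).map (CliffordAlgebra.equivExterior Q).symm
  refine ⟨Module.Finite.of_basis b, ?_⟩
  rw [Module.finrank_eq_card_basis b]
  simp

theorem Mod.equiv {n : ℕ} {s : Fin n → ℝ} {A : Type} [Ring A] [Algebra ℝ A]
    (h : Mod (Fin n) s A) :
    Nonempty (CliffordAlgebra (QuadraticMap.weightedSumSquares ℝ s) ≃ₐ[ℝ] A) := by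
  obtain ⟨e, h1, h2, h3, h4⟩ := h
  set Q := QuadraticMap.weightedSumSquares ℝ s
  obtain ⟨hfin, hrank⟩ := finrank_cliff n Q
  let f : (Fin n → ℝ) →ₗ[ℝ] A := Fintype.linearCombination ℝ e
  have hf : ∀ m, f m * f m = algebraMap ℝ A (Q m) := by
    intro m
    have key : f m * f m + f m * f m = algebraMap ℝ A (Q m) + algebraMap ℝ A (Q m) := by
      have e1 : f m * f m = ∑ i, ∑ j, (m i * m j) • (e i * e j) := by
        simp only [f, Fintype.linearCombination_apply, Finset.sum_mul_sum, smul_mul_smul_comm]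
      have e2 : f m * f m = ∑ i, ∑ j, (m i * m j) • (e j * e i) := by
        rw [e1, Finset.sum_comm]
        simp only [mul_comm]
      have e3 : ∀ i j, (m i * m j) • (e i * e j) + (m i * m j) • (e j * e i)
          = if i = j then (2 * (m i * m i)) • algebraMap ℝ A (s i) else 0 := by
        intro i j
        split_ifs with hij
        · subst hij
          rw [h1, ← add_smul]; congr 1; ring
        · rw [h2 i j hij]; simp
      nth_rewrite 1 [e1]
      rw [e2]
      simp only [← Finset.sum_add_distrib, e3]
      simp only [Finset.sum_ite_eq, Finset.mem_univ, if_true, Q,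
        QuadraticMap.weightedSumSquares_apply, ← map_add, map_sum, Algebra.smul_def, ← map_mul,
        Finset.sum_add_distrib]
      rw [← map_sum, ← map_sum, ← map_add, ← Finset.sum_add_distrib]
      congr 1
      refine Finset.sum_congr rfl fun i _ => ?_
      simp only [Algebra.algebraMap_self_apply]; ring
    have h5 : (2 : ℝ) • (f m * f m) = (2 : ℝ) • algebraMap ℝ A (Q m) := by
      rw [two_smul, two_smul, key]
    exact smul_right_injective A (two_ne_zero : (2 : ℝ) ≠ 0) h5
  let F := CliffordAlgebra.lift Q ⟨f, hf⟩
  have hsurj : Function.Surjective F := by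
    rw [← AlgHom.range_eq_top, eq_top_iff, ← h3]
    refine Algebra.adjoin_le ?_
    rintro _ ⟨i, rfl⟩
    refine ⟨CliffordAlgebra.ι Q (Pi.single i 1), ?_⟩
    simp [F, f]
  have : Module.Finite ℝ A := Module.finite_of_finrank_pos (by rw [h4]; positivity)
  have hinj : Function.Injective F := by
    have := (LinearMap.injective_iff_surjective_of_finrank_eq_finrank
      (f := F.toLinearMap) (by rw [hrank, h4]; simp)).2 hsurj
    exact this
  exact ⟨AlgEquiv.ofBijective F ⟨hinj, hsurj⟩⟩

theorem Mod.flip {κ : Type} [Fintype κ] {s t : Option κ → ℝ} {A : Type} [Ring A] [Algebra ℝ A]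
    (h : Mod (Option κ) s A) (hs : s none = 1) (ht : t none = 1)
    (hst : ∀ k, t (some k) = - s (some k)) : Mod (Option κ) t A := by
  obtain ⟨e, h1, h2, h3, h4⟩ := h
  have hn : e none * e none = 1 := by simp [h1, hs]
  have hc : ∀ k, e none * e (some k) = -(e (some k) * e none) := fun k => h2 _ _ (by simp)
  have hm : ∀ i j, e (some i) * e none * (e (some j) * e none) = -(e (some i) * e (some j)) := by
    intro i j
    calc _ = e (some i) * (e none * e (some j)) * e none := by noncomm_ring
      _ = -(e (some i) * e (some j) * (e none * e none)) := by rw [hc]; noncomm_ring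
      _ = _ := by rw [hn, mul_one]
  refine ⟨fun o => o.elim (e none) (fun k => e (some k) * e none), ?_, ?_, ?_, h4⟩
  · rintro (_ | k)
    · simp [hn, ht]
    · simp only [Option.elim_some, hm, h1, hst, map_neg]
  · rintro (_ | i) (_ | j) hij
    · simp at hij
    · simp only [Option.elim_some, Option.elim_none]
      rw [← mul_assoc, hc]; noncomm_ring
    · simp only [Option.elim_some, Option.elim_none]
      rw [← mul_assoc (e none), hc]; noncomm_ring
    · simp only [Option.elim_some, hm]
      rw [h2 _ _ hij]
  · rw [eq_top_iff, ← h3]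
    refine Algebra.adjoin_le ?_
    rintro _ ⟨i, rfl⟩
    have m0 : e none ∈ Algebra.adjoin ℝ (Set.range (fun o : Option κ =>
      o.elim (e none) (fun k => e (some k) * e none))) := Algebra.subset_adjoin ⟨none, rfl⟩
    rcases i with _ | k
    · exact m0
    · have m1 : e (some k) * e none ∈ Algebra.adjoin ℝ (Set.range (fun o : Option κ =>
        o.elim (e none) (fun k => e (some k) * e none))) := Algebra.subset_adjoin ⟨some k, rfl⟩
      have := mul_mem m1 m0
      rwa [mul_assoc, hn, mul_one] at this

theorem Mod.shift {κ : Type} [Fintype κ] {s t : Fin 4 ⊕ κ → ℝ} {A : Type} [Ring A] [Algebra ℝ A]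
    (h : Mod (Fin 4 ⊕ κ) s A) (hs : ∀ i, s (.inl i) = 1) (ht : ∀ i, t (.inl i) = -1)
    (hst : ∀ k, t (.inr k) = s (.inr k)) : Mod (Fin 4 ⊕ κ) t A := by
  obtain ⟨e, h1, h2, h3, h4⟩ := h
  obtain ⟨w, hw⟩ : ∃ w, w = e (.inl 0) * e (.inl 1) * e (.inl 2) * e (.inl 3) := ⟨_, rfl⟩
  have sq : ∀ i, e (.inl i) * e (.inl i) = 1 := fun i => by simp [h1, hs]
  have ac : ∀ i j : Fin 4, i < j → e (.inl j) * e (.inl i) = -(e (.inl i) * e (.inl j)) :=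
    fun i j hij => h2 _ _ (by simpa using hij.ne')
  have ack : ∀ (i : Fin 4) k, e (.inr k) * e (.inl i) = -(e (.inl i) * e (.inr k)) :=
    fun i k => h2 _ _ (by simp)
  have a10 := ac 0 1 (by decide)
  have a20 := ac 0 2 (by decide)
  have a30 := ac 0 3 (by decide)
  have a21 := ac 1 2 (by decide)
  have a31 := ac 1 3 (by decide)
  have a32 := ac 2 3 (by decide)
  -- left-associated versions, for rewriting inside products
  have asc : ∀ {x y z : A}, x * y = z → ∀ u, x * (y * u) = z * u := by
    intro x y z hh u; rw [← mul_assoc, hh]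
  have hwi : ∀ i, w * e (.inl i) = -(e (.inl i) * w) := by
    intro i
    rw [hw]
    fin_cases i <;>
    simp only [Fin.zero_eta, Fin.mk_one, Fin.reduceFinMk, mul_assoc, a10, a20, a30, a21, a31, a32,
      asc a10, asc a20, asc a30, asc a21, asc a31, asc a32, sq, asc (sq _), neg_mul, mul_neg,
      neg_neg, mul_one, one_mul]
  have hwk : ∀ k, w * e (.inr k) = e (.inr k) * w := by
    intro k
    rw [hw]
    simp only [mul_assoc, ack, asc (ack _ _), neg_mul, mul_neg, neg_neg]
  have hww : w * w = 1 := by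
    rw [hw]
    simp only [mul_assoc, a10, a20, a30, a21, a31, a32,
      asc a10, asc a20, asc a30, asc a21, asc a31, asc a32, sq, asc (sq _), neg_mul, mul_neg,
      neg_neg, mul_one, one_mul]
  have hm : ∀ i j, e (.inl i) * w * (e (.inl j) * w) = -(e (.inl i) * e (.inl j)) := by
    intro i j
    calc _ = e (.inl i) * (w * e (.inl j)) * w := by noncomm_ring
      _ = -(e (.inl i) * e (.inl j) * (w * w)) := by rw [hwi]; noncomm_ring
      _ = _ := by rw [hww, mul_one]
  obtain ⟨e', he'⟩ : ∃ e' : Fin 4 ⊕ κ → A,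
    e' = Sum.elim (fun i => e (.inl i) * w) (fun k => e (.inr k)) := ⟨_, rfl⟩
  have hl : ∀ i, e' (.inl i) = e (.inl i) * w := fun i => by rw [he']; rfl
  have hr : ∀ i, e' (.inr i) = e (.inr i) := fun i => by rw [he']; rfl
  have mem : ∀ i, e' i ∈ Algebra.adjoin ℝ (Set.range e') := fun i => Algebra.subset_adjoin ⟨i, rfl⟩
  refine ⟨e', ?_, ?_, ?_, h4⟩
  · rintro (i | k)
    · rw [hl, hm, sq, ht]; simp
    · rw [hr, h1, hst]
  · rintro (i | i) (j | j) hij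
    · rw [hl, hl, hm, hm, h2 _ _ hij]
    · rw [hl, hr, mul_assoc, hwk, ← mul_assoc, ← mul_assoc, ack]; noncomm_ring
    · rw [hl, hr, mul_assoc, hwk, ← mul_assoc, ← mul_assoc, ack, neg_mul]
    · rw [hr, hr, h2 _ _ hij]
  · have hwm : w ∈ Algebra.adjoin ℝ (Set.range e') := by
      have := mul_mem (mul_mem (mem (.inl 0)) (mem (.inl 1)))
        (mul_mem (mem (.inl 2)) (mem (.inl 3)))
      simp only [hl, hm] at this
      rwa [neg_mul_neg, ← mul_assoc, ← hw] at this
    rw [eq_top_iff, ← h3]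
    refine Algebra.adjoin_le ?_
    rintro _ ⟨i | k, rfl⟩
    · have := mul_mem (mem (.inl i)) hwm
      rwa [hl, mul_assoc, hww, mul_one] at this
    · have := mem (.inr k)
      rwa [hr] at this

theorem Mod.mat {κ : Type} [Fintype κ] {s : κ → ℝ} {t : Option (Option κ) → ℝ}
    {A : Type} [Ring A] [Algebra ℝ A]
    (h : Mod κ s A) (ht : t none = 1) (ht' : t (some none) = -1)
    (hst : ∀ k, t (some (some k)) = s k) :
    Mod (Option (Option κ)) t (Matrix (Fin 2) (Fin 2) A) := by
  obtain ⟨e, h1, h2, h3, h4⟩ := h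
  have : Module.Finite ℝ A := Module.finite_of_finrank_pos (by rw [h4]; positivity)
  obtain ⟨E, hE⟩ : ∃ E : Option (Option κ) → Matrix (Fin 2) (Fin 2) A,
    E = fun o => o.elim !![0, 1; 1, 0]
      (fun o => o.elim !![0, 1; -1, 0] (fun k => !![e k, 0; 0, -e k])) := ⟨_, rfl⟩
  have E0 : E none = !![0, 1; 1, 0] := by rw [hE]; rfl
  have E1 : E (some none) = !![0, 1; -1, 0] := by rw [hE]; rfl
  have E2 : ∀ k, E (some (some k)) = !![e k, 0; 0, -e k] := fun k => by rw [hE]; rfl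
  have mem : ∀ i, E i ∈ Algebra.adjoin ℝ (Set.range E) := fun i => Algebra.subset_adjoin ⟨i, rfl⟩
  refine ⟨E, ?_, ?_, ?_, ?_⟩
  · rintro (_ | _ | k)
    · rw [E0, ht]
      ext i j; fin_cases i <;> fin_cases j <;> simp [Matrix.mul_apply, Matrix.algebraMap_matrix_apply]
    · rw [E1, ht']
      ext i j; fin_cases i <;> fin_cases j <;> simp [Matrix.mul_apply, Matrix.algebraMap_matrix_apply]
    · rw [E2, hst]
      ext i j; fin_cases i <;> fin_cases j <;>
        simp [Matrix.mul_apply, Matrix.algebraMap_matrix_apply, h1]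
  · rintro (_ | _ | i) (_ | _ | j) hij
    all_goals first | exact absurd rfl hij | skip
    all_goals simp only [E0, E1, E2]
    all_goals try (ext a b; fin_cases a <;> fin_cases b <;> simp [Matrix.mul_apply]; done)
    have hij' : i ≠ j := fun hh => hij (by rw [hh])
    ext a b; fin_cases a <;> fin_cases b <;> simp [Matrix.mul_apply, h2 i j hij']
  · have mN := mem none
    have mJ := mem (some none)
    have mD := mul_mem mN mJ
    have eD : E none * E (some none) = !![-1, 0; 0, 1] := by
      rw [E0, E1]
      ext i j; fin_cases i <;> fin_cases j <;> simp [Matrix.mul_apply]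
    rw [eD] at mD
    have msc : ∀ a : A, Matrix.scalarAlgHom (Fin 2) ℝ a ∈ Algebra.adjoin ℝ (Set.range E) := by
      have : Algebra.adjoin ℝ (Set.range e) ≤
          (Algebra.adjoin ℝ (Set.range E)).comap (Matrix.scalarAlgHom (Fin 2) ℝ) := by
        refine Algebra.adjoin_le ?_
        rintro _ ⟨k, rfl⟩
        have := mul_mem (mem (some (some k))) (neg_mem mD)
        have hh : E (some (some k)) * -!![-1, 0; 0, 1] = Matrix.scalarAlgHom (Fin 2) ℝ (e k) := by
          rw [E2]
          ext i j; fin_cases i <;> fin_cases j <;> simp [Matrix.mul_apply]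
        rw [hh] at this
        exact this
      rw [h3] at this
      intro a
      exact this (Algebra.mem_top)
    rw [eq_top_iff]
    intro m _
    have half' : ∀ x : A, (2⁻¹ : ℝ) • (2 * x) = x := fun x => by
      rw [two_mul, ← two_smul ℝ, smul_smul]; simp
    have half : ∀ x : A, (2⁻¹ : ℝ) • (x * 2) = x := fun x => by
      rw [mul_two, ← two_smul ℝ, smul_smul]; simp
    have hm : m = (1 / 2 : ℝ) • (Matrix.scalarAlgHom (Fin 2) ℝ (m 0 0) * (1 - !![-1, 0; 0, 1])
        + Matrix.scalarAlgHom (Fin 2) ℝ (m 1 1) * (1 + !![-1, 0; 0, 1])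
        + Matrix.scalarAlgHom (Fin 2) ℝ (m 0 1) * (E none + E (some none))
        + Matrix.scalarAlgHom (Fin 2) ℝ (m 1 0) * (E none - E (some none))) := by
      rw [E0, E1]
      ext i j; fin_cases i <;> fin_cases j <;>
        simp [Matrix.mul_apply, ← two_smul ℝ, smul_smul, one_add_one_eq_two, half, half']
    rw [hm]
    exact Subalgebra.smul_mem _ (add_mem (add_mem (add_mem
      (mul_mem (msc _) (sub_mem (one_mem _) mD)) (mul_mem (msc _) (add_mem (one_mem _) mD)))
      (mul_mem (msc _) (add_mem mN mJ))) (mul_mem (msc _) (sub_mem mN mJ))) _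
  · rw [Module.finrank_matrix, h4]
    simp [pow_succ]; ring

/-- the signs of the form of signature `(p, q)` -/
def sg (p q : ℕ) : Fin p ⊕ Fin q → ℝ := Sum.elim (fun _ => 1) (fun _ => -1)

/-- `A` is a model of the Clifford algebra of signature `(p, q)` -/
def M (p q : ℕ) (A : Type) [Ring A] [Algebra ℝ A] : Prop := Mod (Fin p ⊕ Fin q) (sg p q) A

theorem M.equiv {p q : ℕ} {A : Type} [Ring A] [Algebra ℝ A] (h : M p q A) :
    Nonempty (RealCliffordAlgebra p q ≃ₐ[ℝ] A) := by
  refine Mod.equiv (Mod.reindex h finSumFinEquiv.symm ?_)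
  intro k
  obtain ⟨k, rfl⟩ := finSumFinEquiv.surjective k
  rcases k with k | k <;> simp [sg]

/-- adding a positive generator -/
def E1 (p q : ℕ) : Option (Fin p ⊕ Fin q) ≃ Fin (p + 1) ⊕ Fin q where
  toFun o := o.elim (.inl 0) (Sum.elim (fun i => .inl i.succ) .inr)
  invFun := Sum.elim (Fin.cases none (fun i => some (.inl i))) (fun j => some (.inr j))
  left_inv := by rintro (_ | i | j) <;> simp
  right_inv := by
    rintro (i | j)
    · induction i using Fin.cases <;> simp
    · simp

/-- adding a negative generator -/
def E2 (p q : ℕ) : Option (Fin p ⊕ Fin q) ≃ Fin p ⊕ Fin (q + 1) where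
  toFun o := o.elim (.inr 0) (Sum.elim .inl (fun i => .inr i.succ))
  invFun := Sum.elim (fun j => some (.inl j)) (Fin.cases none (fun i => some (.inr i)))
  left_inv := by rintro (_ | i | j) <;> simp
  right_inv := by
    rintro (i | j)
    · simp
    · induction j using Fin.cases <;> simp

theorem M.flip {p q : ℕ} {A : Type} [Ring A] [Algebra ℝ A] (h : M (p + 1) q A) :
    M (q + 1) p A := by
  have h1 := Mod.reindex h (E1 p q) (fun k => rfl)
  have h2 := Mod.flip h1 (t := fun o => sg (q + 1) p (E1 q p (o.map Sum.swap)))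
    (by simp [E1, sg]) (by simp [E1, sg]) (by rintro (i | j) <;> simp [E1, sg])
  refine Mod.reindex h2 ((E1 q p).symm.trans (Equiv.optionCongr (Equiv.sumComm _ _))) ?_
  intro k
  obtain ⟨k, rfl⟩ := (E1 q p).surjective k
  rcases k with _ | i | j <;> simp [E1, sg]

theorem M.shift {p q : ℕ} {A : Type} [Ring A] [Algebra ℝ A] (h : M (4 + p) q A) :
    M p (4 + q) A := by
  let f : Fin 4 ⊕ (Fin p ⊕ Fin q) ≃ Fin (4 + p) ⊕ Fin q :=
    (Equiv.sumAssoc _ _ _).symm.trans (Equiv.sumCongr finSumFinEquiv (Equiv.refl _))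
  let g : Fin 4 ⊕ (Fin p ⊕ Fin q) ≃ Fin p ⊕ Fin (4 + q) :=
    ((Equiv.sumAssoc _ _ _).symm.trans
      (Equiv.sumCongr (Equiv.sumComm _ _) (Equiv.refl _))).trans
      ((Equiv.sumAssoc _ _ _).trans (Equiv.sumCongr (Equiv.refl _) finSumFinEquiv))
  have h1 := Mod.reindex h f (fun k => rfl)
  have h2 := Mod.shift h1 (t := fun o => sg p (4 + q) (g o))
    (by intro i; simp [f, sg]) (by intro i; simp [g, sg])
    (by rintro (i | j) <;> simp [f, g, sg])
  exact Mod.reindex h2 g.symm (fun k => by simp)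

theorem M.mat {p q : ℕ} {A : Type} [Ring A] [Algebra ℝ A] (h : M p q A) :
    M (p + 1) (q + 1) (Matrix (Fin 2) (Fin 2) A) := by
  let f : Option (Option (Fin p ⊕ Fin q)) ≃ Fin (p + 1) ⊕ Fin (q + 1) :=
    (Equiv.optionCongr (E2 p q)).trans (E1 p (q + 1))
  have h2 := Mod.mat h (t := fun o => sg (p + 1) (q + 1) (f o))
    (by simp [f, E1, sg]) (by simp [f, E1, E2, sg])
    (by rintro (i | j) <;> simp [f, E1, E2, sg])
  exact Mod.reindex h2 f.symm (fun k => by simp)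

theorem M.map {p q : ℕ} {A B : Type} [Ring A] [Algebra ℝ A] [Ring B] [Algebra ℝ B]
    (h : M p q A) (f : A ≃ₐ[ℝ] B) : M p q B := Mod.map h f

/-- block matrices -/
noncomputable def matEquiv (k : ℕ) (R : Type) [Ring R] [Algebra ℝ R] :
    Matrix (Fin 2) (Fin 2) (Mat (2 ^ k) R) ≃ₐ[ℝ] Mat (2 ^ (k + 1)) R :=
  (Matrix.compAlgEquiv (Fin 2) (Fin (2 ^ k)) R ℝ).trans
    (Matrix.reindexAlgEquiv ℝ R (finProdFinEquiv.trans (finCongr (by rw [pow_succ, mul_comm]))))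

/-- matrices over a product -/
def matProd (n : Type) [Fintype n] [DecidableEq n] (A B : Type) [Ring A] [Algebra ℝ A]
    [Ring B] [Algebra ℝ B] : Matrix n n (A × B) ≃ₐ[ℝ] Matrix n n A × Matrix n n B where
  toFun m := (m.map Prod.fst, m.map Prod.snd)
  invFun m := Matrix.of fun i j => (m.1 i j, m.2 i j)
  left_inv m := by ext <;> rfl
  right_inv m := by ext <;> rfl
  map_mul' m m' := by
    ext <;> simp [Matrix.mul_apply, Prod.fst_sum, Prod.snd_sum]
  map_add' m m' := by ext <;> simp
  commutes' r := by
    ext i j <;> by_cases h : i = j <;> simp [Matrix.algebraMap_matrix_apply, h]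

theorem M.mat' {p q k : ℕ} {R : Type} [Ring R] [Algebra ℝ R] (h : M p q (Mat (2 ^ k) R)) :
    M (p + 1) (q + 1) (Mat (2 ^ (k + 1)) R) := h.mat.map (matEquiv k R)

theorem M.matProd {p q k : ℕ} {R : Type} [Ring R] [Algebra ℝ R]
    (h : M p q (Mat (2 ^ k) R × Mat (2 ^ k) R)) :
    M (p + 1) (q + 1) (Mat (2 ^ (k + 1)) R × Mat (2 ^ (k + 1)) R) :=
  h.mat.map ((CliffClass.matProd _ _ _).trans (AlgEquiv.prodCongr (matEquiv k R) (matEquiv k R)))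

/-- `1 × 1` matrices -/
def matOne' (R : Type) [Ring R] [Algebra ℝ R] : R ≃ₐ[ℝ] Mat 1 R where
  toFun r := Matrix.of fun _ _ => r
  invFun m := m 0 0
  left_inv r := rfl
  right_inv m := by
    ext i j
    rw [Subsingleton.elim i 0, Subsingleton.elim j 0]; rfl
  map_mul' x y := by ext i j; simp [Matrix.mul_apply]
  map_add' x y := by ext i j; simp
  commutes' r := by
    ext i j
    simp [Matrix.algebraMap_matrix_apply, Subsingleton.elim i j]

/-- `1 × 1` matrices -/
noncomputable def matOne (R : Type) [Ring R] [Algebra ℝ R] : R ≃ₐ[ℝ] Mat (2 ^ 0) R :=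
  (matOne' R).trans (Matrix.reindexAlgEquiv ℝ R (finCongr (pow_zero 2).symm))

theorem M00 : M 0 0 ℝ := by
  refine ⟨fun _ => 0, fun i => isEmptyElim i, fun i => isEmptyElim i, ?_, by simp⟩
  rw [eq_top_iff]
  intro x _
  exact Subalgebra.algebraMap_mem _ x

theorem M10 : M 1 0 (ℝ × ℝ) := by
  refine ⟨fun _ => (1, -1), ?_, ?_, ?_, ?_⟩
  · rintro (i | i)
    · ext <;> simp [sg]
    · exact i.elim0
  · rintro (i | i) (j | j) hij
    all_goals first
      | exact i.elim0
      | exact j.elim0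
      | exact absurd (congrArg _ (Subsingleton.elim i j)) hij
  · rw [eq_top_iff]
    intro x _
    have hx : x = ((x.1 + x.2) / 2) • (1 : ℝ × ℝ) + ((x.1 - x.2) / 2) • (1, -1) := by
      ext <;> simp <;> ring
    rw [hx]
    exact add_mem (Subalgebra.smul_mem _ (one_mem _) _)
      (Subalgebra.smul_mem _ (Algebra.subset_adjoin (Set.mem_range_self (Sum.inl 0))) _)
  · simp

theorem M01 : M 0 1 ℂ := by
  refine ⟨fun _ => Complex.I, ?_, ?_, ?_, ?_⟩
  · rintro (i | i)
    · exact i.elim0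
    · simp [sg]
  · rintro (i | i) (j | j) hij
    all_goals first
      | exact i.elim0
      | exact j.elim0
      | exact absurd (congrArg _ (Subsingleton.elim i j)) hij
  · rw [eq_top_iff]
    intro x _
    have hx : x = x.re • (1 : ℂ) + x.im • Complex.I := by
      apply Complex.ext <;> simp
    rw [hx]
    exact add_mem (Subalgebra.smul_mem _ (one_mem _) _)
      (Subalgebra.smul_mem _ (Algebra.subset_adjoin (Set.mem_range_self (Sum.inr 0))) _)
  · simp [Complex.finrank_real_complex]

/-- quaternion units -/
def qi : Quaternion ℝ := ⟨0, 1, 0, 0⟩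
/-- quaternion units -/
def qj : Quaternion ℝ := ⟨0, 0, 1, 0⟩
/-- quaternion units -/
def qk : Quaternion ℝ := ⟨0, 0, 0, 1⟩

open scoped Quaternion

@[simp] theorem qi_re : qi.re = 0 := rfl
@[simp] theorem qi_imI : qi.imI = 1 := rfl
@[simp] theorem qi_imJ : qi.imJ = 0 := rfl
@[simp] theorem qi_imK : qi.imK = 0 := rfl
@[simp] theorem qj_re : qj.re = 0 := rfl
@[simp] theorem qj_imI : qj.imI = 0 := rfl
@[simp] theorem qj_imJ : qj.imJ = 1 := rfl
@[simp] theorem qj_imK : qj.imK = 0 := rfl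
@[simp] theorem qk_re : qk.re = 0 := rfl
@[simp] theorem qk_imI : qk.imI = 0 := rfl
@[simp] theorem qk_imJ : qk.imJ = 0 := rfl
@[simp] theorem qk_imK : qk.imK = 1 := rfl

theorem qii : qi * qi = -1 := by ext <;> simp
theorem qjj : qj * qj = -1 := by ext <;> simp
theorem qkk : qk * qk = -1 := by ext <;> simp
theorem qij : qi * qj = qk := by ext <;> simp
theorem qji : qj * qi = -qk := by ext <;> simp
theorem qjk : qj * qk = qi := by ext <;> simp
theorem qkj : qk * qj = -qi := by ext <;> simp
theorem qki : qk * qi = qj := by ext <;> simp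
theorem qik : qi * qk = -qj := by ext <;> simp
theorem qdec (x : Quaternion ℝ) :
    x = x.re • 1 + x.imI • qi + x.imJ • qj + x.imK • qk := by
  ext <;> simp

theorem M02 : M 0 2 (Quaternion ℝ) := by
  obtain ⟨e, he⟩ : ∃ e : Fin 0 ⊕ Fin 2 → Quaternion ℝ, e = Sum.elim (fun _ => 0) ![qi, qj] :=
    ⟨_, rfl⟩
  have e0 : e (.inr 0) = qi := by rw [he]; rfl
  have e1 : e (.inr 1) = qj := by rw [he]; rfl
  have mem : ∀ i, e i ∈ Algebra.adjoin ℝ (Set.range e) := fun i => Algebra.subset_adjoin ⟨i, rfl⟩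
  refine ⟨e, ?_, ?_, ?_, ?_⟩
  · rintro (i | i)
    · exact i.elim0
    · fin_cases i <;> simp [sg, e0, e1, qii, qjj]
  · rintro (i | i) (j | j) hij
    · exact i.elim0
    · exact i.elim0
    · exact j.elim0
    · fin_cases i <;> fin_cases j <;> simp [e0, e1, qij, qji] at hij ⊢
  · rw [eq_top_iff]
    intro x _
    have m0 := mem (.inr 0)
    have m1 := mem (.inr 1)
    have m2 := mul_mem m0 m1
    rw [e0] at m0
    rw [e1] at m1
    rw [e0, e1, qij] at m2
    rw [qdec x]
    exact add_mem (add_mem (add_mem (Subalgebra.smul_mem _ (one_mem _) _)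
      (Subalgebra.smul_mem _ m0 _)) (Subalgebra.smul_mem _ m1 _)) (Subalgebra.smul_mem _ m2 _)
  · rw [Quaternion.finrank_eq_four]; simp

theorem M03 : M 0 3 (Quaternion ℝ × Quaternion ℝ) := by
  obtain ⟨e, he⟩ : ∃ e : Fin 0 ⊕ Fin 3 → Quaternion ℝ × Quaternion ℝ,
    e = Sum.elim (fun _ => 0) ![(qi, qi), (qj, qj), (qk, -qk)] := ⟨_, rfl⟩
  have e0 : e (.inr 0) = (qi, qi) := by rw [he]; rfl
  have e1 : e (.inr 1) = (qj, qj) := by rw [he]; rfl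
  have e2 : e (.inr 2) = (qk, -qk) := by rw [he]; rfl
  have mem : ∀ i, e i ∈ Algebra.adjoin ℝ (Set.range e) := fun i => Algebra.subset_adjoin ⟨i, rfl⟩
  refine ⟨e, ?_, ?_, ?_, ?_⟩
  · rintro (i | i)
    · exact i.elim0
    · fin_cases i <;> simp [sg, e0, e1, e2, qii, qjj, qkk, Prod.ext_iff]
  · rintro (i | i) (j | j) hij
    · exact i.elim0
    · exact i.elim0
    · exact j.elim0
    · fin_cases i <;> fin_cases j <;>
        simp [e0, e1, e2, qij, qji, qik, qki, qjk, qkj] at hij ⊢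
  · rw [eq_top_iff]
    intro x _
    have m0 := mem (.inr 0)
    have m1 := mem (.inr 1)
    have m2 := mem (.inr 2)
    rw [e0] at m0
    rw [e1] at m1
    rw [e2] at m2
    have m3 := mul_mem m0 m1
    have mw := mul_mem m2 m3
    simp only [Prod.mk_mul_mk, qij] at m3
    simp only [Prod.mk_mul_mk, qij, qkk, neg_mul, neg_neg] at mw
    have md : ∀ y : Quaternion ℝ, (y, y) ∈ Algebra.adjoin ℝ (Set.range e) := by
      intro y
      have hy : (y, y) = y.re • 1 + y.imI • (qi, qi) + y.imJ • (qj, qj) + y.imK • (qk, qk) := by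
        apply Prod.ext
        · exact qdec y
        · exact qdec y
      rw [hy]
      exact add_mem (add_mem (add_mem (Subalgebra.smul_mem _ (one_mem _) _)
        (Subalgebra.smul_mem _ m0 _)) (Subalgebra.smul_mem _ m1 _)) (Subalgebra.smul_mem _ m3 _)
    have hx : x = (1 / 2 : ℝ) • ((x.1, x.1) * (1 - (-1, 1)) + (x.2, x.2) * (1 + (-1, 1))) := by
      have half' : ∀ x : Quaternion ℝ, (2⁻¹ : ℝ) • (x * 2) = x := fun x => by
        rw [mul_two, ← two_smul ℝ, smul_smul]; simp
      apply Prod.ext <;> simp [one_add_one_eq_two, half']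
    rw [hx]
    exact Subalgebra.smul_mem _ (add_mem (mul_mem (md _) (sub_mem (one_mem _) mw))
      (mul_mem (md _) (add_mem (one_mem _) mw))) _
  · rw [Module.finrank_prod, Quaternion.finrank_eq_four]; simp

/-- the classification at `(p, q)` -/
def T (p q : ℕ) : Prop :=
    ((((p : ℤ) - q) % 8 = 0 ∨ ((p : ℤ) - q) % 8 = 2 →
      M p q (Mat (2 ^ ((p + q) / 2)) ℝ)) ∧
    (((p : ℤ) - q) % 8 = 1 →
      M p q (Mat (2 ^ ((p + q - 1) / 2)) ℝ × Mat (2 ^ ((p + q - 1) / 2)) ℝ)) ∧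
    ((((p : ℤ) - q) % 8 = 3 ∨ ((p : ℤ) - q) % 8 = 7) →
      M p q (Mat (2 ^ ((p + q - 1) / 2)) ℂ)) ∧
    ((((p : ℤ) - q) % 8 = 4 ∨ ((p : ℤ) - q) % 8 = 6) →
      M p q (Mat (2 ^ ((p + q - 2) / 2)) (Quaternion ℝ))) ∧
    (((p : ℤ) - q) % 8 = 5 →
      M p q (Mat (2 ^ ((p + q - 3) / 2)) (Quaternion ℝ) ×
          Mat (2 ^ ((p + q - 3) / 2)) (Quaternion ℝ))))

theorem T.flip {p q : ℕ} (h : T (p + 1) q) : T (q + 1) p := by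
  obtain ⟨h1, h2, h3, h4, h5⟩ := h
  have e : p + 1 + q = q + 1 + p := by omega
  rw [e] at h1 h2 h3 h4 h5
  exact ⟨fun h => (h1 (by omega)).flip, fun h => (h2 (by omega)).flip,
    fun h => (h3 (by omega)).flip, fun h => (h4 (by omega)).flip, fun h => (h5 (by omega)).flip⟩

theorem T.shift {p q : ℕ} (h : T (4 + p) q) : T p (4 + q) := by
  obtain ⟨h1, h2, h3, h4, h5⟩ := h
  have e : 4 + p + q = p + (4 + q) := by omega
  rw [e] at h1 h2 h3 h4 h5
  exact ⟨fun h => (h1 (by omega)).shift, fun h => (h2 (by omega)).shift,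
    fun h => (h3 (by omega)).shift, fun h => (h4 (by omega)).shift, fun h => (h5 (by omega)).shift⟩

theorem T.mat {p q : ℕ} (h : T p q) : T (p + 1) (q + 1) := by
  obtain ⟨h1, h2, h3, h4, h5⟩ := h
  refine ⟨fun h => ?_, fun h => ?_, fun h => ?_, fun h => ?_, fun h => ?_⟩
  · rw [show (p + 1 + (q + 1)) / 2 = (p + q) / 2 + 1 by omega]
    exact (h1 (by omega)).mat'
  · rw [show (p + 1 + (q + 1) - 1) / 2 = (p + q - 1) / 2 + 1 by omega]
    exact (h2 (by omega)).matProd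
  · rw [show (p + 1 + (q + 1) - 1) / 2 = (p + q - 1) / 2 + 1 by omega]
    exact (h3 (by omega)).mat'
  · rw [show (p + 1 + (q + 1) - 2) / 2 = (p + q - 2) / 2 + 1 by omega]
    exact (h4 (by omega)).mat'
  · rw [show (p + 1 + (q + 1) - 3) / 2 = (p + q - 3) / 2 + 1 by omega]
    exact (h5 (by omega)).matProd

theorem T00 : T 0 0 :=
  ⟨fun _ => M00.map (matOne ℝ), fun h => by omega, fun h => by omega, fun h => by omega,
    fun h => by omega⟩

theorem T10 : T 1 0 :=
  ⟨fun h => by omega, fun _ => M10.map (AlgEquiv.prodCongr (matOne ℝ) (matOne ℝ)),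
    fun h => by omega, fun h => by omega, fun h => by omega⟩

theorem T01 : T 0 1 :=
  ⟨fun h => by omega, fun h => by omega, fun _ => M01.map (matOne ℂ), fun h => by omega,
    fun h => by omega⟩

theorem T02 : T 0 2 :=
  ⟨fun h => by omega, fun h => by omega, fun h => by omega, fun _ => M02.map (matOne _),
    fun h => by omega⟩

theorem T03 : T 0 3 :=
  ⟨fun h => by omega, fun h => by omega, fun h => by omega, fun h => by omega,
    fun _ => M03.map (AlgEquiv.prodCongr (matOne _) (matOne _))⟩

theorem T_all : ∀ n p q : ℕ, p + q = n → T p q := by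
  intro n
  induction n using Nat.strong_induction_on with
  | _ n ih =>
    intro p q hn
    match p, q, hn with
    | 0, 0, _ => exact T00
    | 1, 0, _ => exact T10
    | 0, 1, _ => exact T01
    | 0, 2, _ => exact T02
    | 0, 3, _ => exact T03
    | p + 1, q + 1, hn => exact (ih (p + q) (by omega) p q rfl).mat
    | p + 2, 0, hn => exact T.flip (p := 0) (q := p + 1) (ih p (by omega) 0 p (by omega)).mat
    | 0, 4, _ => exact T.shift (p := 0) (q := 0) (T.flip (p := 0) (q := 3) T02.mat)
    | 0, q + 5, hn =>
      have h := T.shift (p := 0) (q := q + 1) (ih (3 + q) (by omega) 3 q rfl).mat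
      rwa [show 4 + (q + 1) = q + 5 by omega] at h

end CliffClass

/-- Classification of real Clifford algebras. -/
theorem real_clifford_classification (p q : ℕ) :
    ((((p : ℤ) - q) % 8 = 0 ∨ ((p : ℤ) - q) % 8 = 2 →
      Nonempty (RealCliffordAlgebra p q ≃ₐ[ℝ] Mat (2 ^ ((p + q) / 2)) ℝ)) ∧
    (((p : ℤ) - q) % 8 = 1 →
      Nonempty (RealCliffordAlgebra p q ≃ₐ[ℝ]
        (Mat (2 ^ ((p + q - 1) / 2)) ℝ × Mat (2 ^ ((p + q - 1) / 2)) ℝ))) ∧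
    ((((p : ℤ) - q) % 8 = 3 ∨ ((p : ℤ) - q) % 8 = 7) →
      Nonempty (RealCliffordAlgebra p q ≃ₐ[ℝ] Mat (2 ^ ((p + q - 1) / 2)) ℂ)) ∧
    ((((p : ℤ) - q) % 8 = 4 ∨ ((p : ℤ) - q) % 8 = 6) →
      Nonempty (RealCliffordAlgebra p q ≃ₐ[ℝ] Mat (2 ^ ((p + q - 2) / 2)) (Quaternion ℝ))) ∧
    (((p : ℤ) - q) % 8 = 5 →
      Nonempty (RealCliffordAlgebra p q ≃ₐ[ℝ]
        (Mat (2 ^ ((p + q - 3) / 2)) (Quaternion ℝ) ×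
          Mat (2 ^ ((p + q - 3) / 2)) (Quaternion ℝ))))) := by
  obtain ⟨h1, h2, h3, h4, h5⟩ := CliffClass.T_all _ p q rfl
  exact ⟨fun h => (h1 h).equiv, fun h => (h2 h).equiv, fun h => (h3 h).equiv, fun h => (h4 h).equiv,
    fun h => (h5 h).equiv⟩
end

section
/- Classification of complex Clifford algebras: for every natural number n, the complex Clifford algebra ℂCl(n) is isomorphic as a ℂ-algebra to the matrix algebra Mat(2^{n/2}, ℂ) if n is even, and to the product Mat(2^{(n−1)/2}, ℂ) × Mat(2^{(n−1)/2}, ℂ) if n is odd. -/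
/-- The quadratic form `Qℂ_n` on `ℂ^n`: `Qℂ_n(x) = ∑_{i<n} x_i²`. -/
noncomputable def Qc (n : ℕ) : QuadraticForm ℂ (Fin n → ℂ) :=
  QuadraticMap.weightedSumSquares ℂ (fun _ : Fin n => (1 : ℂ))

/-- The complex Clifford algebra `ℂCl(n)`. -/
noncomputable abbrev ComplexCliffordAlgebra (n : ℕ) := CliffordAlgebra (Qc n)

/-- The algebra of `k × k` complex matrices. -/
abbrev MatC (k : ℕ) := Matrix (Fin k) (Fin k) ℂ

section MatrixLift

variable {A B : Type*} [Ring A] [Ring B] [Algebra ℂ A] [Algebra ℂ B]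

/-- Matrix units commuting with the image of `ψ` give a hom out of a matrix algebra. -/
noncomputable def matLift (ψ : A →ₐ[ℂ] B) (E : Fin 2 → Fin 2 → B)
    (hE : ∀ i j k l, E i j * E k l = if j = k then E i l else 0)
    (h1 : E 0 0 + E 1 1 = 1) (hc : ∀ a i j, E i j * ψ a = ψ a * E i j) :
    Matrix (Fin 2) (Fin 2) A →ₐ[ℂ] B :=
  AlgHom.ofLinearMap
    { toFun := fun M => ∑ i, ∑ j, ψ (M i j) * E i j
      map_add' := by
        intro M N
        simp [add_mul, Finset.sum_add_distrib]
      map_smul' := by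
        intro c M
        simp [Finset.smul_sum] }
    (by simp [Fin.sum_univ_two, h1])
    (by
      intro M N
      have key : ∀ i j k l a b, (ψ a * E i j) * (ψ b * E k l)
          = if j = k then ψ a * ψ b * E i l else 0 := by
        intro i j k l a b
        rw [mul_assoc, ← mul_assoc (E i j), hc, mul_assoc, hE]
        split_ifs <;> simp [mul_assoc]
      simp only [LinearMap.coe_mk, AddHom.coe_mk, Fin.sum_univ_two, Matrix.mul_apply, map_add,
        map_mul, add_mul, mul_add, key]
      simp
      abel)

theorem matLift_apply (ψ : A →ₐ[ℂ] B) (E hE h1 hc) (M : Matrix (Fin 2) (Fin 2) A) :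
    matLift ψ E hE h1 hc M = ∑ i, ∑ j, ψ (M i j) * E i j := rfl

/-- Matrix units from a pair of anticommuting involutions. -/
noncomputable def pauliE (X Y : B) : Fin 2 → Fin 2 → B :=
  ![![(1/2 : ℂ) • (1 - Complex.I • (X * Y)), (1/2 : ℂ) • (X + Complex.I • Y)],
    ![(1/2 : ℂ) • (X - Complex.I • Y), (1/2 : ℂ) • (1 + Complex.I • (X * Y))]]

theorem pauliE_mul (X Y : B) (hX : X * X = 1) (hY : Y * Y = 1) (hYX : Y * X = -(X * Y))
    (i j k l : Fin 2) :
    pauliE X Y i j * pauliE X Y k l = if j = k then pauliE X Y i l else 0 := by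
  have hX' : ∀ w, X * (X * w) = w := fun w => by rw [← mul_assoc, hX, one_mul]
  have hY' : ∀ w, Y * (Y * w) = w := fun w => by rw [← mul_assoc, hY, one_mul]
  have hYX' : ∀ w, Y * (X * w) = -(X * (Y * w)) := fun w => by
    rw [← mul_assoc, hYX, neg_mul, mul_assoc]
  fin_cases i <;> fin_cases j <;> fin_cases k <;> fin_cases l <;>
    simp [pauliE, mul_add, add_mul, mul_sub, sub_mul, mul_assoc, hX, hY, hYX, hX', hY', hYX',
      smul_smul, smul_sub, smul_add] <;>
    (try match_scalars) <;> (try ring_nf) <;> (try simp) <;> (try norm_num)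

theorem pauliE_one (X Y : B) : pauliE X Y 0 0 + pauliE X Y 1 1 = 1 := by
  simp [pauliE]
  module

end MatrixLift

section Step

variable (n : ℕ)

theorem Qc_apply (v : Fin n → ℂ) : Qc n v = ∑ i, v i * v i := by
  simp [Qc, QuadraticMap.weightedSumSquares_apply]

/-- Forget the first two coordinates. -/
noncomputable def tl : (Fin (n + 2) → ℂ) →ₗ[ℂ] (Fin n → ℂ) :=
  LinearMap.funLeft ℂ ℂ (fun i => i.succ.succ)

/-- Insert two zero coordinates. -/
noncomputable def ins : (Fin n → ℂ) →ₗ[ℂ] (Fin (n + 2) → ℂ) where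
  toFun v := Fin.cons 0 (Fin.cons 0 v)
  map_add' v w := by
    ext i
    refine Fin.cases ?_ (fun i => ?_) i
    · simp
    · refine Fin.cases ?_ (fun i => ?_) i <;> simp
  map_smul' c v := by
    ext i
    refine Fin.cases ?_ (fun i => ?_) i
    · simp
    · refine Fin.cases ?_ (fun i => ?_) i <;> simp

theorem Qc_succ (v : Fin (n + 2) → ℂ) :
    Qc (n + 2) v = v 0 * v 0 + v 1 * v 1 + Qc n (tl n v) := by
  simp [Qc_apply, Fin.sum_univ_succ, tl, LinearMap.funLeft_apply, add_assoc]

@[simp] theorem ins_zero (v : Fin n → ℂ) : ins n v 0 = 0 := rfl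
@[simp] theorem ins_one (v : Fin n → ℂ) : ins n v 1 = 0 := rfl
@[simp] theorem tl_ins (v : Fin n → ℂ) : tl n (ins n v) = v := rfl
@[simp] theorem tl_single_zero : tl n (Pi.single 0 1) = 0 := by
  ext i; simp [tl, LinearMap.funLeft_apply]
@[simp] theorem tl_single_one : tl n (Pi.single 1 1) = 0 := by
  ext i
  have : (i.succ.succ : Fin (n + 2)) ≠ 1 := by
    intro h; simpa [Fin.ext_iff] using h
  simp [tl, LinearMap.funLeft_apply, this]

theorem decomp (v : Fin (n + 2) → ℂ) :
    v = ins n (tl n v) + v 0 • Pi.single 0 1 + v 1 • Pi.single 1 1 := by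
  ext i
  refine Fin.cases ?_ (fun i => ?_) i
  · simp
  · refine Fin.cases ?_ (fun i => ?_) i
    · simp
    · have : (i.succ.succ : Fin (n + 2)) ≠ 1 := by
        intro h; simpa [Fin.ext_iff] using h
      simp [this]
      rfl

open CliffordAlgebra

/-- The map `ℂCl(n+2) → M₂(ℂCl(n))`. -/
noncomputable def fwdLin : (Fin (n + 2) → ℂ) →ₗ[ℂ] Matrix (Fin 2) (Fin 2) (CliffordAlgebra (Qc n)) where
  toFun v := !![ι (Qc n) (tl n v), algebraMap ℂ _ (v 0 - Complex.I * v 1);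
    algebraMap ℂ _ (v 0 + Complex.I * v 1), - ι (Qc n) (tl n v)]
  map_add' v w := by
    ext i j
    fin_cases i <;> fin_cases j <;> simp [mul_add] <;> abel
  map_smul' c v := by
    ext i j
    fin_cases i <;> fin_cases j <;> simp [Algebra.algebraMap_eq_smul_one] <;> module

noncomputable def fwd :
    CliffordAlgebra (Qc (n + 2)) →ₐ[ℂ] Matrix (Fin 2) (Fin 2) (CliffordAlgebra (Qc n)) :=
  lift (Qc (n + 2)) ⟨fwdLin n, by
    intro v
    have hI : ∀ z : ℂ, Complex.I * (Complex.I * z) = - z := fun z => by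
      rw [← mul_assoc, Complex.I_mul_I]; ring
    rw [Qc_succ]
    ext i j
    fin_cases i <;> fin_cases j <;>
      simp [fwdLin, Matrix.mul_apply, Fin.sum_univ_two, Matrix.algebraMap_matrix_apply, 
        ι_sq_scalar, Algebra.algebraMap_eq_smul_one, smul_smul] <;>
      (match_scalars <;> ring_nf <;> simp <;> ring)⟩

theorem fwd_ι (v) : fwd n (ι _ v) = !![ι (Qc n) (tl n v), algebraMap ℂ _ (v 0 - Complex.I * v 1);
    algebraMap ℂ _ (v 0 + Complex.I * v 1), - ι (Qc n) (tl n v)] := by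
  simp [fwd, lift_ι_apply, fwdLin]

noncomputable def gX : CliffordAlgebra (Qc (n + 2)) := ι _ (Pi.single 0 1)
noncomputable def gY : CliffordAlgebra (Qc (n + 2)) := ι _ (Pi.single 1 1)

theorem gX_sq : gX n * gX n = 1 := by
  rw [gX, ι_sq_scalar, Qc_succ]; simp

theorem gY_sq : gY n * gY n = 1 := by
  rw [gY, ι_sq_scalar, Qc_succ]; simp

theorem anti (v w : Fin (n + 2) → ℂ) (h : Qc (n + 2) (v + w) = Qc (n + 2) v + Qc (n + 2) w) :
    ι (Qc (n + 2)) v * ι _ w = - (ι _ w * ι _ v) :=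
  ι_mul_ι_comm_of_isOrtho (QuadraticMap.isOrtho_def.2 h)

theorem gYX : gY n * gX n = - (gX n * gY n) := by
  apply anti; simp [Qc_succ]

theorem gSX (v) : ι _ (ins n v) * gX n = - (gX n * ι _ (ins n v)) := by
  apply anti; simp [Qc_succ]; ring

theorem gSY (v) : ι _ (ins n v) * gY n = - (gY n * ι _ (ins n v)) := by
  apply anti; simp [Qc_succ]; ring

noncomputable def gZ : CliffordAlgebra (Qc (n + 2)) := (-Complex.I) • (gX n * gY n)

theorem gZ_sq : gZ n * gZ n = 1 := by
  have h : gX n * gY n * (gX n * gY n) = -1 := by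
    rw [mul_assoc, ← mul_assoc (gY n), gYX, neg_mul, mul_neg, mul_assoc, gY_sq, mul_one, gX_sq]
  simp [gZ, smul_smul, h]

theorem gZX : gZ n * gX n = - (gX n * gZ n) := by
  simp [gZ, mul_assoc, gYX]

theorem gZY : gZ n * gY n = - (gY n * gZ n) := by
  simp [gZ, ← mul_assoc, gYX]

theorem gSZ (v) : ι _ (ins n v) * gZ n = gZ n * ι _ (ins n v) := by
  simp only [gZ, mul_smul_comm, smul_mul_assoc]
  rw [← mul_assoc, gSX, neg_mul, mul_assoc, gSY]; simp [mul_assoc]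

noncomputable def psi : CliffordAlgebra (Qc n) →ₐ[ℂ] CliffordAlgebra (Qc (n + 2)) :=
  lift (Qc n) ⟨(LinearMap.mulRight ℂ (gZ n)).comp ((ι _).comp (ins n)), by
    intro v
    simp only [LinearMap.comp_apply, LinearMap.mulRight_apply]
    rw [mul_assoc, ← mul_assoc (gZ n), ← gSZ, mul_assoc, gZ_sq, mul_one, ι_sq_scalar, Qc_succ]
    simp⟩

theorem psi_ι (v) : psi n (ι _ v) = ι _ (ins n v) * gZ n := by
  simp [psi, lift_ι_apply]

theorem psi_comm_of (b : CliffordAlgebra (Qc (n + 2)))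
    (h : ∀ v, Commute b (psi n (ι _ v))) (a) : Commute b (psi n a) := by
  induction a using CliffordAlgebra.induction with
  | algebraMap r => rw [AlgHom.commutes]; exact (Algebra.commutes r b).symm
  | ι v => exact h v
  | mul x y hx hy => rw [map_mul]; exact hx.mul_right hy
  | add x y hx hy => rw [map_add]; exact hx.add_right hy

theorem psi_X (a) : Commute (gX n) (psi n a) := by
  apply psi_comm_of
  intro v
  rw [psi_ι, Commute, SemiconjBy, mul_assoc, gZX, mul_neg, ← mul_assoc, ← mul_assoc, gSX]
  simp

theorem psi_Y (a) : Commute (gY n) (psi n a) := by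
  apply psi_comm_of
  intro v
  rw [psi_ι, Commute, SemiconjBy, mul_assoc, gZY, mul_neg, ← mul_assoc, ← mul_assoc, gSY]
  simp

noncomputable def bwd :
    Matrix (Fin 2) (Fin 2) (CliffordAlgebra (Qc n)) →ₐ[ℂ] CliffordAlgebra (Qc (n + 2)) :=
  matLift (psi n) (pauliE (gX n) (gY n)) (pauliE_mul _ _ (gX_sq n) (gY_sq n) (gYX n))
    (pauliE_one _ _) (by
      intro a i j
      have hX := psi_X n a
      have hY := psi_Y n a
      have hXY := hX.mul_left hY
      fin_cases i <;> fin_cases j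
      · exact (((Commute.one_left _).sub_left (hXY.smul_left _)).smul_left _)
      · exact ((hX.add_left (hY.smul_left _)).smul_left _)
      · exact ((hX.sub_left (hY.smul_left _)).smul_left _)
      · exact (((Commute.one_left _).add_left (hXY.smul_left _)).smul_left _))

theorem bwd_fwd : (bwd n).comp (fwd n) = AlgHom.id ℂ _ := by
  refine CliffordAlgebra.hom_ext (LinearMap.ext fun v => ?_)
  have hv : ι (Qc (n + 2)) v = ι _ (ins n (tl n v)) + v 0 • gX n + v 1 • gY n := by
    conv_lhs => rw [decomp n v]
    simp [gX, gY]
  have h2 : pauliE (gX n) (gY n) 0 0 - pauliE (gX n) (gY n) 1 1 = gZ n := by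
    simp [pauliE, gZ]
    module
  have hS : ι (Qc (n + 2)) (ins n (tl n v))
      = psi n (ι _ (tl n v)) * (pauliE (gX n) (gY n) 0 0 - pauliE (gX n) (gY n) 1 1) := by
    rw [h2, psi_ι, mul_assoc, gZ_sq, mul_one]
  have hXY : v 0 • gX n + v 1 • gY n =
      (v 0 - Complex.I * v 1) • pauliE (gX n) (gY n) 0 1
        + (v 0 + Complex.I * v 1) • pauliE (gX n) (gY n) 1 0 := by
    simp [pauliE]
    match_scalars <;> ring_nf <;> simp <;> ring
  simp only [LinearMap.comp_apply, AlgHom.toLinearMap_apply, AlgHom.comp_apply, AlgHom.id_apply]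
  rw [fwd_ι, hv, add_assoc, hS, hXY, bwd, matLift_apply]
  simp only [Fin.sum_univ_two, Matrix.of_apply, Matrix.cons_val_zero, Matrix.cons_val_one,
    AlgHom.commutes, map_neg, neg_mul, mul_sub, Algebra.algebraMap_eq_smul_one, map_smul, map_one,
    smul_mul_assoc, one_mul]
  abel

theorem fwd_X : fwd n (gX n) = !![0, 1; 1, 0] := by
  rw [gX, fwd_ι]; simp

theorem fwd_Y : fwd n (gY n) = !![0, algebraMap ℂ _ (-Complex.I); algebraMap ℂ _ Complex.I, 0] := by
  rw [gY, fwd_ι]; simp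

theorem fwd_Z : fwd n (gZ n) = !![1, 0; 0, -1] := by
  simp only [gZ, map_smul, map_mul, fwd_X, fwd_Y]
  ext i j
  fin_cases i <;> fin_cases j <;>
    simp [Algebra.algebraMap_eq_smul_one, smul_smul]

theorem fwd_psi (a) : fwd n (psi n a) = !![a, 0; 0, a] := by
  induction a using CliffordAlgebra.induction with
  | algebraMap r =>
    rw [AlgHom.commutes, AlgHom.commutes]
    ext i j
    fin_cases i <;> fin_cases j <;> simp [Matrix.algebraMap_matrix_apply]
  | ι v =>
    rw [psi_ι, map_mul, fwd_Z, fwd_ι]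
    ext i j
    fin_cases i <;> fin_cases j <;> simp
  | mul x y hx hy => rw [map_mul, map_mul, hx, hy]; simp
  | add x y hx hy => rw [map_add, map_add, hx, hy]; simp

theorem fwd_E (i j : Fin 2) : fwd n (pauliE (gX n) (gY n) i j) = Matrix.single i j 1 := by
  fin_cases i <;> fin_cases j <;>
    simp only [pauliE, Fin.zero_eta, Fin.mk_one, Matrix.cons_val_zero, Matrix.cons_val_one,
      map_smul, map_sub, map_add, map_one, map_mul, fwd_X, fwd_Y] <;>
    ext k l <;> fin_cases k <;> fin_cases l <;>
    simp [Algebra.algebraMap_eq_smul_one, smul_smul, Matrix.single] <;> module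

theorem fwd_bwd : (fwd n).comp (bwd n) = AlgHom.id ℂ _ := by
  apply AlgHom.ext
  intro M
  simp only [AlgHom.comp_apply, AlgHom.id_apply, bwd, matLift_apply, map_add, map_mul, fwd_psi,
    fwd_E, Fin.sum_univ_two]
  ext k l
  fin_cases k <;> fin_cases l <;> simp [Matrix.mul_apply, Matrix.single, Matrix.vecHead, Matrix.vecTail]

noncomputable def stepEquiv :
    CliffordAlgebra (Qc (n + 2)) ≃ₐ[ℂ] Matrix (Fin 2) (Fin 2) (CliffordAlgebra (Qc n)) :=
  AlgEquiv.ofAlgHom (fwd n) (bwd n) (fwd_bwd n) (bwd_fwd n)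

end Step

section Base

open CliffordAlgebra

noncomputable def base0 : CliffordAlgebra (Qc 0) ≃ₐ[ℂ] ℂ :=
  AlgEquiv.ofAlgHom (lift (Qc 0) ⟨0, fun v => by simp [Qc_apply]⟩) (Algebra.ofId ℂ _)
    (by ext)
    (by
      refine CliffordAlgebra.hom_ext (LinearMap.ext fun v => ?_)
      have : v = 0 := Subsingleton.elim _ _
      rw [this, map_zero, map_zero])

noncomputable def base1Fwd : CliffordAlgebra (Qc 1) →ₐ[ℂ] ℂ × ℂ :=
  lift (Qc 1) ⟨(LinearMap.proj 0).prod (-(LinearMap.proj 0)), fun v => by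
    ext <;> simp [Qc_apply]⟩

theorem base1Fwd_ι (v) : base1Fwd (ι _ v) = (v 0, - v 0) := by
  rw [base1Fwd, lift_ι_apply]; rfl

noncomputable def base1e : CliffordAlgebra (Qc 1) := ι _ (Pi.single 0 1)

theorem base1e_sq : base1e * base1e = 1 := by
  rw [base1e, ι_sq_scalar, Qc_apply]; simp

noncomputable def base1Bwd : ℂ × ℂ →ₐ[ℂ] CliffordAlgebra (Qc 1) :=
  AlgHom.ofLinearMap
    { toFun := fun p => ((p.1 + p.2) / 2) • 1 + ((p.1 - p.2) / 2) • base1e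
      map_add' := by
        intro p q
        simp
        module
      map_smul' := by
        intro c p
        simp
        module }
    (by simp)
    (by
      intro p q
      simp [mul_add, add_mul, base1e_sq, smul_smul]
      module)

theorem base1Bwd_apply (p) :
    base1Bwd p = ((p.1 + p.2) / 2) • 1 + ((p.1 - p.2) / 2) • base1e := rfl

noncomputable def base1 : CliffordAlgebra (Qc 1) ≃ₐ[ℂ] ℂ × ℂ :=
  AlgEquiv.ofAlgHom base1Fwd base1Bwd
    (by
      apply AlgHom.ext
      intro p
      simp only [AlgHom.comp_apply, AlgHom.id_apply, base1Bwd_apply, map_add, map_smul, map_one,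
        base1e, base1Fwd_ι]
      ext <;> simp <;> ring)
    (by
      refine CliffordAlgebra.hom_ext (LinearMap.ext fun v => ?_)
      have hv : v = v 0 • Pi.single 0 1 := by
        ext i
        have : i = 0 := Subsingleton.elim _ _
        simp [this]
      have : ι (Qc 1) v = v 0 • base1e := by
        conv_lhs => rw [hv]
        simp [base1e]
      simp only [LinearMap.comp_apply, AlgHom.toLinearMap_apply, AlgHom.comp_apply,
        AlgHom.id_apply, base1Fwd_ι, base1Bwd_apply]
      rw [this]
      simp)

/-- Matrices over a product. -/
def matProd (m A B : Type*) [Fintype m] [DecidableEq m] [Ring A] [Ring B] [Algebra ℂ A]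
    [Algebra ℂ B] : Matrix m m (A × B) ≃ₐ[ℂ] Matrix m m A × Matrix m m B where
  toFun M := (M.map Prod.fst, M.map Prod.snd)
  invFun P := Matrix.of fun i j => (P.1 i j, P.2 i j)
  left_inv M := by ext <;> rfl
  right_inv P := by ext <;> rfl
  map_mul' M N := by
    ext <;> simp [Matrix.mul_apply, Prod.fst_sum, Prod.snd_sum]
  map_add' M N := by ext <;> simp
  commutes' r := by
    ext i j <;> simp [Matrix.algebraMap_matrix_apply] <;> split_ifs <;> simp

/-- `ℂ` as `1 × 1` matrices. -/
noncomputable def matOne : ℂ ≃ₐ[ℂ] MatC 1 :=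
  AlgEquiv.ofBijective (Algebra.ofId ℂ (MatC 1)) (by
    constructor
    · intro a b h
      have := congrFun (congrFun h 0) 0
      simpa [Algebra.ofId_apply, Matrix.algebraMap_matrix_apply] using this
    · intro M
      refine ⟨M 0 0, ?_⟩
      ext i j
      fin_cases i
      fin_cases j
      simp [Algebra.ofId_apply, Matrix.algebraMap_matrix_apply])

/-- `2 × 2` block matrices. -/
noncomputable def matDouble (k : ℕ) : Matrix (Fin 2) (Fin 2) (MatC (2 ^ k)) ≃ₐ[ℂ] MatC (2 ^ (k + 1)) :=
  (Matrix.compAlgEquiv (Fin 2) (Fin (2 ^ k)) ℂ ℂ).trans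
    (Matrix.reindexAlgEquiv ℂ ℂ (finProdFinEquiv.trans (finCongr (by ring))))

theorem even_case (k : ℕ) : Nonempty (CliffordAlgebra (Qc (2 * k)) ≃ₐ[ℂ] MatC (2 ^ k)) := by
  induction k with
  | zero => exact ⟨base0.trans matOne⟩
  | succ k ih =>
    obtain ⟨e⟩ := ih
    exact ⟨(stepEquiv (2 * k)).trans (e.mapMatrix.trans (matDouble k))⟩

theorem odd_case (k : ℕ) :
    Nonempty (CliffordAlgebra (Qc (2 * k + 1)) ≃ₐ[ℂ] MatC (2 ^ k) × MatC (2 ^ k)) := by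
  induction k with
  | zero => exact ⟨base1.trans (AlgEquiv.prodCongr matOne matOne)⟩
  | succ k ih =>
    obtain ⟨e⟩ := ih
    exact ⟨(stepEquiv (2 * k + 1)).trans (e.mapMatrix.trans ((matProd _ _ _).trans
      (AlgEquiv.prodCongr (matDouble k) (matDouble k))))⟩

end Base

/-- Classification of complex Clifford algebras. -/
theorem complex_clifford_classification (n : ℕ) :
    (Even n → Nonempty (ComplexCliffordAlgebra n ≃ₐ[ℂ] MatC (2 ^ (n / 2)))) ∧
    (Odd n → Nonempty (ComplexCliffordAlgebra n ≃ₐ[ℂ]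
      (MatC (2 ^ ((n - 1) / 2)) × MatC (2 ^ ((n - 1) / 2))))) := by
  constructor
  · intro h
    obtain ⟨k, rfl⟩ := even_iff_exists_two_mul.1 h
    rw [show 2 * k / 2 = k by omega]
    exact even_case k
  · rintro ⟨k, rfl⟩
    rw [show (2 * k + 1 - 1) / 2 = k by omega]
    exact odd_case k
end

section
/- For every even natural number n, the complex Clifford algebra ℂCl(n) is a central simple ℂ-algebra: it is a simple ring and its center consists exactly of the scalar multiples of the identity (i.e., it is central over ℂ). -/
namespace CliffAux

variable {A : Type*} [Ring A] [Algebra ℂ A] {n : ℕ}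

/-- Monomial attached to a list of indices. -/
def mon (e : Fin n → A) (l : List (Fin n)) : A := (l.map e).prod

/-- Averaging over conjugation by `e i`. -/
noncomputable def avg (e : Fin n → A) (i : Fin n) : A →ₗ[ℂ] A :=
  (2⁻¹ : ℂ) • (LinearMap.id + (LinearMap.mulLeft ℂ (e i)).comp (LinearMap.mulRight ℂ (e i)))

lemma avg_apply (e : Fin n → A) (i : Fin n) (x : A) :
    avg e i x = (2⁻¹ : ℂ) • (x + e i * (x * e i)) := by
  simp [avg]

/-- Iterated averaging. -/
noncomputable def avgs (e : Fin n → A) : List (Fin n) → A → A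
  | [], x => x
  | i :: L, x => avg e i (avgs e L x)

/-- Iterated averaging, as a linear map. -/
noncomputable def avgL (e : Fin n → A) : List (Fin n) → A →ₗ[ℂ] A
  | [] => LinearMap.id
  | i :: L => (avg e i).comp (avgL e L)

lemma mon_append (e : Fin n → A) (a b : List (Fin n)) :
    mon e (a ++ b) = mon e a * mon e b := by simp [mon]

lemma mon_cons (e : Fin n → A) (i : Fin n) (b : List (Fin n)) :
    mon e (i :: b) = e i * mon e b := by simp [mon]

lemma comm_mon (e : Fin n → A)
    (h2 : ∀ i j, i ≠ j → e i * e j = -(e j * e i)) (i : Fin n) (l : List (Fin n)) :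
    e i * mon e l = ((-1 : ℂ) ^ (l.length + l.count i)) • (mon e l * e i) := by
  induction l with
  | nil => simp [mon]
  | cons j l ih =>
    rw [mon_cons]
    by_cases hij : i = j
    · subst hij
      rw [mul_assoc (e i) (mon e l), ih, List.length_cons, List.count_cons_self, mul_smul_comm]
      congr 1
      ring
    · rw [← mul_assoc, h2 i j hij, neg_mul, mul_assoc, ih, List.length_cons,
        List.count_cons_of_ne (Ne.symm hij), mul_smul_comm, ← mul_assoc, ← neg_smul]
      congr 1
      ring

lemma conj_mon (e : Fin n → A) (h1 : ∀ i, e i * e i = 1)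
    (h2 : ∀ i j, i ≠ j → e i * e j = -(e j * e i)) (i : Fin n) (l : List (Fin n)) :
    e i * (mon e l * e i) = ((-1 : ℂ) ^ (l.length + l.count i)) • mon e l := by
  rw [← mul_assoc, comm_mon e h2, smul_mul_assoc, mul_assoc, h1, mul_one]

lemma rev_mul (e : Fin n → A) (h1 : ∀ i, e i * e i = 1) (l : List (Fin n)) :
    mon e l.reverse * mon e l = 1 := by
  induction l with
  | nil => simp [mon]
  | cons j l ih =>
    rw [List.reverse_cons, mon_append, mon_cons, mon_cons]
    have : mon e ([] : List (Fin n)) = 1 := by simp [mon]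
    rw [this, mul_one, mul_assoc, ← mul_assoc (e j), h1, one_mul, ih]

lemma scalar_of_even (e : Fin n → A) (h1 : ∀ i, e i * e i = 1)
    (h2 : ∀ i j, i ≠ j → e i * e j = -(e j * e i)) (N : ℕ) :
    ∀ l : List (Fin n), l.length ≤ N → (∀ i, Even (l.count i)) →
      ∃ c : ℂ, mon e l = c • (1 : A) := by
  induction N with
  | zero =>
    intro l hl _
    have : l = [] := List.length_eq_zero_iff.mp (by omega)
    subst this
    exact ⟨1, by simp [mon]⟩
  | succ N ih =>
    intro l hl hev
    cases l with
    | nil => exact ⟨1, by simp [mon]⟩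
    | cons i l =>
      have hi : i ∈ l := by
        have := hev i
        rw [List.count_cons_self] at this
        rw [← List.count_pos_iff]
        rcases Nat.eq_zero_or_pos (l.count i) with h | h
        · rw [h] at this; exact absurd this (by decide)
        · exact h
      obtain ⟨a, b, rfl⟩ := List.append_of_mem hi
      obtain ⟨c, hc⟩ := ih (a ++ b) (by simp at hl ⊢; omega) (by
        intro j
        have := hev j
        by_cases hj : i = j
        · subst hj
          simp only [List.count_cons_self, List.count_append] at this ⊢
          grind
        · simpa [List.count_cons_of_ne hj, List.count_append] using this)
      refine ⟨(-1 : ℂ) ^ (a.length + a.count i) * c, ?_⟩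
      rw [mon_cons, mon_append, mon_cons, ← mul_assoc, ← mul_assoc, mul_assoc (e i),
        conj_mon e h1 h2, smul_mul_assoc, ← mon_append, hc, smul_smul]

lemma avgL_mon (e : Fin n → A) (h1 : ∀ i, e i * e i = 1)
    (h2 : ∀ i j, i ≠ j → e i * e j = -(e j * e i)) (l L : List (Fin n)) :
    ((∀ i ∈ L, Even (l.length + l.count i)) → avgL e L (mon e l) = mon e l) ∧
    ((∃ i ∈ L, ¬ Even (l.length + l.count i)) → avgL e L (mon e l) = 0) := by
  induction L with
  | nil => simp [avgL]
  | cons j L ih =>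
    have key1 : Even (l.length + l.count j) → avg e j (mon e l) = mon e l := by
      intro h
      rw [avg_apply, conj_mon e h1 h2, h.neg_one_pow, one_smul, ← two_smul ℂ, smul_smul]
      norm_num
    have key2 : ¬ Even (l.length + l.count j) → avg e j (mon e l) = 0 := by
      intro h
      rw [avg_apply, conj_mon e h1 h2, (Nat.not_even_iff_odd.mp h).neg_one_pow]
      simp
    constructor
    · intro h
      simp only [avgL, LinearMap.comp_apply]
      rw [ih.1 (fun i hi => h i (by simp [hi])), key1 (h j (by simp))]
    · intro h
      simp only [avgL, LinearMap.comp_apply]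
      by_cases hL : ∃ i ∈ L, ¬ Even (l.length + l.count i)
      · rw [ih.2 hL, map_zero]
      · have hL' := hL
        push Not at hL'
        rw [ih.1 hL']
        apply key2
        obtain ⟨i, hi, hh⟩ := h
        rcases List.mem_cons.mp hi with rfl | hi
        · exact hh
        · exact absurd ⟨i, hi, hh⟩ hL

lemma parity (hn : Even n) (l : List (Fin n)) (h : ∀ i, Even (l.length + l.count i)) :
    ∀ i, Even (l.count i) := by
  have hs : ∑ i, l.count i = l.length := by
    have := Multiset.sum_count_eq_card (s := Finset.univ) (m := (l : Multiset (Fin n)))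
      (fun _ _ => Finset.mem_univ _)
    simpa using this
  have hlen : Even l.length := by
    have h3 : Even (∑ i : Fin n, (l.length + l.count i)) :=
      Finset.even_sum _ (fun i _ => h i)
    rw [Finset.sum_add_distrib, hs] at h3
    simp only [Finset.sum_const, Finset.card_univ, Fintype.card_fin, smul_eq_mul] at h3
    exact (Nat.even_add.mp h3).mp (hn.mul_right _)
  intro i
  exact (Nat.even_add.mp (h i)).mp hlen

/-- Full averaging. -/
noncomputable def P (e : Fin n → A) : A →ₗ[ℂ] A := avgL e (List.finRange n)

lemma P_even (e : Fin n → A) (h1 : ∀ i, e i * e i = 1)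
    (h2 : ∀ i j, i ≠ j → e i * e j = -(e j * e i)) (l : List (Fin n))
    (h : ∀ i, Even (l.count i)) : P e (mon e l) = mon e l := by
  refine (avgL_mon e h1 h2 l _).1 (fun i _ => ?_)
  have hs : ∑ i, l.count i = l.length := by
    have := Multiset.sum_count_eq_card (s := Finset.univ) (m := (l : Multiset (Fin n)))
      (fun _ _ => Finset.mem_univ _)
    simpa using this
  rw [← hs]
  exact (Finset.even_sum _ (fun i _ => h i)).add (h i)

lemma P_not_even (e : Fin n → A) (h1 : ∀ i, e i * e i = 1)
    (h2 : ∀ i j, i ≠ j → e i * e j = -(e j * e i)) (hn : Even n) (l : List (Fin n))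
    (h : ¬ ∀ i, Even (l.count i)) : P e (mon e l) = 0 := by
  refine (avgL_mon e h1 h2 l _).2 ?_
  by_contra hc
  push Not at hc
  exact h (parity hn l (fun i => hc i (List.mem_finRange i)))

lemma span_mon (e : Fin n → A) (h3 : Algebra.adjoin ℂ (Set.range e) = ⊤) (x : A) :
    x ∈ Submodule.span ℂ (Set.range (mon e)) := by
  have hx : x ∈ Subalgebra.toSubmodule (Algebra.adjoin ℂ (Set.range e)) := by
    rw [h3]; trivial
  rw [Algebra.adjoin_eq_span] at hx
  refine Submodule.span_mono ?_ hx
  intro y hy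
  induction hy using Submonoid.closure_induction with
  | mem y hy => obtain ⟨i, rfl⟩ := hy; exact ⟨[i], by simp [mon]⟩
  | one => exact ⟨[], by simp [mon]⟩
  | mul a b _ _ ha hb =>
    obtain ⟨a, rfl⟩ := ha
    obtain ⟨b, rfl⟩ := hb
    exact ⟨a ++ b, mon_append e a b⟩

lemma P_scalar (e : Fin n → A) (h1 : ∀ i, e i * e i = 1)
    (h2 : ∀ i j, i ≠ j → e i * e j = -(e j * e i)) (hn : Even n)
    (h3 : Algebra.adjoin ℂ (Set.range e) = ⊤) (x : A) :
    ∃ c : ℂ, P e x = c • (1 : A) := by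
  induction span_mon e h3 x using Submodule.span_induction with
  | mem x hx =>
    obtain ⟨l, rfl⟩ := hx
    by_cases h : ∀ i, Even (l.count i)
    · rw [P_even e h1 h2 l h]
      exact scalar_of_even e h1 h2 _ l le_rfl h
    · exact ⟨0, by rw [P_not_even e h1 h2 hn l h, zero_smul]⟩
  | zero => exact ⟨0, by simp⟩
  | add x y _ _ hx hy =>
    obtain ⟨a, ha⟩ := hx
    obtain ⟨b, hb⟩ := hy
    exact ⟨a + b, by rw [map_add, ha, hb, add_smul]⟩
  | smul c x _ hx =>
    obtain ⟨a, ha⟩ := hx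
    exact ⟨c * a, by rw [map_smul, ha, smul_smul]⟩

lemma reconstruct (e : Fin n → A) (h1 : ∀ i, e i * e i = 1)
    (h2 : ∀ i j, i ≠ j → e i * e j = -(e j * e i)) (hn : Even n)
    (h3 : Algebra.adjoin ℂ (Set.range e) = ⊤) (x : A) :
    ∑ S : Finset (Fin n), P e (x * mon e S.toList.reverse) * mon e S.toList = x := by
  induction span_mon e h3 x using Submodule.span_induction with
  | mem x hx =>
    obtain ⟨l, rfl⟩ := hx
    have hcount : ∀ (S : Finset (Fin n)) (i : Fin n),
        (l ++ S.toList.reverse).count i = l.count i + if i ∈ S then 1 else 0 := by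
      intro S i
      rw [List.count_append, List.count_reverse, List.Nodup.count S.nodup_toList]
      simp
    let S₀ : Finset (Fin n) := Finset.univ.filter (fun i => ¬ Even (l.count i))
    rw [Finset.sum_eq_single S₀]
    · rw [← mon_append, P_even e h1 h2, mon_append, mul_assoc, rev_mul e h1, mul_one]
      intro i
      rw [hcount]
      by_cases h : Even (l.count i)
      · simp only [S₀, Finset.mem_filter, Finset.mem_univ, true_and, h, not_true_eq_false,
          if_false, add_zero]
      · have := Nat.not_even_iff_odd.mp h
        simp only [S₀, Finset.mem_filter, Finset.mem_univ, true_and, h, not_false_eq_true,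
          if_true]
        exact this.add_odd odd_one
    · intro S _ hS
      rw [← mon_append, P_not_even e h1 h2 hn, zero_mul]
      intro hall
      apply hS
      ext i
      have := hall i
      rw [hcount] at this
      simp only [S₀, Finset.mem_filter, Finset.mem_univ, true_and]
      by_cases hi : i ∈ S
      · simp only [hi, if_true] at this
        simp only [hi, true_iff]
        exact Nat.even_add_one.mp this
      · simp only [hi, if_false, add_zero] at this
        simp [hi, this]
    · intro h; exact absurd (Finset.mem_univ _) h
  | zero => simp
  | add x y _ _ hx hy =>
    simp only [add_mul, map_add, Finset.sum_add_distrib]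
    rw [hx, hy]
  | smul c x _ hx =>
    simp only [smul_mul_assoc, map_smul, ← Finset.smul_sum]
    rw [hx]

lemma avgL_mem (e : Fin n → A) (I : TwoSidedIdeal A) (L : List (Fin n)) (x : A) (hx : x ∈ I) :
    avgL e L x ∈ I := by
  induction L with
  | nil => simpa [avgL] using hx
  | cons i L ih =>
    simp only [avgL, LinearMap.comp_apply, avg_apply]
    rw [← one_mul (avgL e L x + _), ← smul_mul_assoc]
    exact I.mul_mem_left _ _ (I.add_mem ih (I.mul_mem_left _ _ (I.mul_mem_right _ _ ih)))

lemma avgL_center (e : Fin n → A) (h1 : ∀ i, e i * e i = 1) (L : List (Fin n)) (x : A)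
    (hx : ∀ y, y * x = x * y) : avgL e L x = x := by
  induction L with
  | nil => simp [avgL]
  | cons i L ih =>
    simp only [avgL, LinearMap.comp_apply, avg_apply]
    rw [ih, ← mul_assoc, hx, mul_assoc, h1, mul_one, ← two_smul ℂ, smul_smul]
    norm_num

theorem main [Nontrivial A] (e : Fin n → A) (h1 : ∀ i, e i * e i = 1)
    (h2 : ∀ i j, i ≠ j → e i * e j = -(e j * e i)) (hn : Even n)
    (h3 : Algebra.adjoin ℂ (Set.range e) = ⊤) :
    IsSimpleRing A ∧ Subalgebra.center ℂ A = ⊥ := by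
  constructor
  · refine ⟨⟨fun I => ?_⟩⟩
    by_cases hI : (1 : A) ∈ I
    · right
      exact I.one_mem_iff.mp hI
    · left
      rw [eq_bot_iff]
      intro x hx
      rw [TwoSidedIdeal.mem_bot]
      rw [← reconstruct e h1 h2 hn h3 x]
      refine Finset.sum_eq_zero (fun S _ => ?_)
      have hm : P e (x * mon e S.toList.reverse) ∈ I :=
        avgL_mem e I _ _ (I.mul_mem_right _ _ hx)
      obtain ⟨c, hc⟩ := P_scalar e h1 h2 hn h3 (x * mon e S.toList.reverse)
      by_cases h0 : c = 0
      · rw [hc, h0, zero_smul, zero_mul]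
      · exfalso
        apply hI
        rw [hc] at hm
        have := I.mul_mem_left (c⁻¹ • (1 : A)) _ hm
        rwa [smul_mul_smul_comm, inv_mul_cancel₀ h0, one_smul, one_mul] at this
  · rw [eq_bot_iff]
    intro x hx
    rw [Subalgebra.mem_center_iff] at hx
    obtain ⟨c, hc⟩ := P_scalar e h1 h2 hn h3 x
    rw [P, avgL_center e h1 _ x hx] at hc
    rw [Algebra.mem_bot]
    exact ⟨c, by rw [hc, Algebra.algebraMap_eq_smul_one]⟩

end CliffAux

/-- For even `n`, the complex Clifford algebra `ℂCl(n)` is a central simple `ℂ`-algebra: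
it is a simple ring and its center is exactly the scalars. -/
theorem complex_clifford_central_simple (n : ℕ) (hn : Even n) :
    IsSimpleRing (ComplexCliffordAlgebra n) ∧
      Subalgebra.center ℂ (ComplexCliffordAlgebra n) = ⊥ := by
  have : Invertible (2 : ℂ) := invertibleOfNonzero two_ne_zero
  have : Nontrivial (ComplexCliffordAlgebra n) := inferInstance
  refine CliffAux.main (fun i => CliffordAlgebra.ι (Qc n) (Pi.single i 1)) ?_ ?_ hn ?_
  · intro i
    rw [CliffordAlgebra.ι_sq_scalar]
    have : Qc n (Pi.single i 1) = 1 := by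
      simp [Qc, QuadraticMap.weightedSumSquares_apply, Pi.single_apply]
    rw [this, map_one]
  · intro i j hij
    rw [eq_neg_iff_add_eq_zero, CliffordAlgebra.ι_mul_ι_add_swap]
    have : QuadraticMap.polar (Qc n) (Pi.single i 1) (Pi.single j 1) = 0 := by
      simp only [QuadraticMap.polar, Qc, QuadraticMap.weightedSumSquares_apply]
      rw [← Finset.sum_sub_distrib, ← Finset.sum_sub_distrib]
      refine Finset.sum_eq_zero (fun k _ => ?_)
      simp only [Pi.add_apply, Pi.single_apply]
      by_cases h : k = i
      · subst h
        simp [hij]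
      · simp [h]
    rw [this, map_zero]
  · rw [eq_top_iff, ← CliffordAlgebra.adjoin_range_ι]
    refine Algebra.adjoin_le ?_
    rintro _ ⟨v, rfl⟩
    rw [pi_eq_sum_univ' v, map_sum]
    refine Subalgebra.sum_mem _ (fun i _ => ?_)
    rw [map_smul]
    refine Subalgebra.smul_mem _ ?_ _
    refine Algebra.subset_adjoin ?_
    refine ⟨i, ?_⟩
    beta_reduce
    congr 1
end

section
/- Every automorphism of a real Clifford algebra of even rank is inner: for all natural numbers p and q with p + q even, and every ℝ-algebra automorphism φ of C(p,q), there exists an invertible element u of C(p,q) such that φ(x) = u * x * u⁻¹ for all x in C(p,q). -/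
section Helper

variable {ι A : Type*} [Fintype ι] [DecidableEq ι] [Ring A] [Algebra ℝ A]

/-- Commuting a generator past a word. -/
lemma gen_mul_word (e : ι → A) (hac : ∀ i j, i ≠ j → e i * e j = -(e j * e i)) (i : ι)
    (l : List ι) :
    e i * (l.map e).prod = (-1 : ℝ) ^ (l.length + l.count i) • ((l.map e).prod * e i) := by
  induction l with
  | nil => simp
  | cons j l ih =>
    rw [List.map_cons, List.prod_cons, List.length_cons, List.count_cons]
    by_cases hij : j = i
    · subst hij
      simp only [beq_self_eq_true, if_true]
      rw [mul_assoc, ih, mul_smul_comm]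
      rw [show l.length + 1 + (l.count j + 1) = l.length + l.count j + 2 by ring,
        pow_add _ _ 2, neg_one_sq, mul_one]
    · have : (j == i) = false := by simpa using hij
      simp only [this, Bool.false_eq_true, if_false]
      rw [← mul_assoc, hac i j (Ne.symm hij), neg_mul, mul_assoc, ih, mul_smul_comm, mul_assoc,
        show l.length + 1 + (l.count i + 0) = l.length + l.count i + 1 by ring, pow_succ]
      simp

/-- Permuting a word changes its product by a scalar. -/
lemma word_perm (e : ι → A) (hac : ∀ i j, i ≠ j → e i * e j = -(e j * e i))
    {l l' : List ι} (h : l.Perm l') :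
    ∃ c : ℝ, (l.map e).prod = c • (l'.map e).prod := by
  induction h with
  | nil => exact ⟨1, by simp⟩
  | cons x _ ih =>
    obtain ⟨c, hc⟩ := ih
    exact ⟨c, by simp [hc]⟩
  | swap x y l =>
    by_cases hxy : y = x
    · exact ⟨1, by simp [hxy]⟩
    · refine ⟨-1, ?_⟩
      simp only [List.map_cons, List.prod_cons]
      rw [← mul_assoc, hac y x hxy]
      simp [mul_assoc]
  | trans _ _ h1 h2 =>
    obtain ⟨c, hc⟩ := h1
    obtain ⟨d, hd⟩ := h2
    exact ⟨c * d, by rw [hc, hd, smul_smul]⟩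

/-- A word with even multiplicities is scalar. -/
lemma word_even (e : ι → A) (s : ι → ℝ) (hsq : ∀ i, e i * e i = s i • (1 : A))
    (hac : ∀ i j, i ≠ j → e i * e j = -(e j * e i)) (n : ℕ) :
    ∀ l : List ι, l.length = n → (∀ i, Even (l.count i)) →
      ∃ c : ℝ, (l.map e).prod = c • (1 : A) := by
  induction n using Nat.strong_induction_on with
  | _ n ih =>
    intro l hl hev
    match l, hl, hev with
    | [], _, _ => exact ⟨1, by simp⟩
    | i :: l, hl, hev =>
      have hi := hev i
      rw [List.count_cons_self] at hi
      have hmem : i ∈ l := by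
        rw [← List.count_pos_iff]
        rcases Nat.eq_zero_or_pos (l.count i) with h0 | h0
        · rw [h0] at hi
          simp at hi
        · exact h0
      have hp : (i :: l).Perm (i :: i :: l.erase i) := (List.perm_cons_erase hmem).cons i
      obtain ⟨c, hc⟩ := word_perm e hac hp
      have hlen := hp.length_eq
      simp only [List.length_cons] at hlen hl
      obtain ⟨d, hd⟩ := ih (l.erase i).length (by omega) (l.erase i) rfl (by
        intro j
        have h1 := hev j
        rw [hp.count_eq, List.count_cons, List.count_cons] at h1
        split_ifs at h1
        · rw [add_assoc] at h1
          simpa [Nat.even_add] using h1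
        · simpa using h1)
      refine ⟨c * s i * d, ?_⟩
      rw [hc]
      simp only [List.map_cons, List.prod_cons]
      rw [hd, ← mul_assoc, hsq]
      simp [smul_smul, mul_assoc, mul_comm d]

/-- In even rank, a word commuting with all generators is scalar. -/
lemma word_central (e : ι → A) (s : ι → ℝ) (hsq : ∀ i, e i * e i = s i • (1 : A))
    (hac : ∀ i j, i ≠ j → e i * e j = -(e j * e i)) (hcard : Even (Fintype.card ι))
    (l : List ι) (h : ∀ i, Even (l.length + l.count i)) :
    ∃ c : ℝ, (l.map e).prod = c • (1 : A) := by
  have hlen : Even l.length := by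
    have h1 : ∑ i, (l.length + l.count i) = Fintype.card ι * l.length + l.length := by
      rw [Finset.sum_add_distrib]
      congr 1
      · simp
      · rw [← List.sum_toFinset_count_eq_length l]
        symm
        apply Finset.sum_subset (Finset.subset_univ _)
        intro x _ hx
        rw [List.count_eq_zero]
        simpa using hx
    have h2 : Even (∑ i, (l.length + l.count i)) := Finset.even_sum _ (fun i _ => h i)
    rw [h1, Nat.even_add] at h2
    exact h2.1 (hcard.mul_right _)
  refine word_even e s hsq hac _ l rfl (fun i => ?_)
  have := h i
  rw [Nat.even_add] at this
  exact this.1 hlen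

/-- Elements commuting with all generators are scalar. -/
lemma central_scalar (e : ι → A) (s : ι → ℝ) (hs : ∀ i, s i * s i = 1)
    (hsq : ∀ i, e i * e i = s i • (1 : A))
    (hac : ∀ i j, i ≠ j → e i * e j = -(e j * e i)) (hcard : Even (Fintype.card ι))
    (hgen : Algebra.adjoin ℝ (Set.range e) = ⊤) (x : A) (hx : ∀ i, e i * x = x * e i) :
    ∃ c : ℝ, x = c • (1 : A) := by
  have key : ∀ t : Finset ι, x ∈ Submodule.span ℝ
      {m : A | ∃ l : List ι, (∀ i ∈ t, Even (l.length + l.count i)) ∧ m = (l.map e).prod} := by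
    intro t
    induction t using Finset.induction_on with
    | empty =>
      have h1 : x ∈ Subalgebra.toSubmodule (Algebra.adjoin ℝ (Set.range e)) := by
        rw [hgen]
        trivial
      rw [Algebra.adjoin_eq_span] at h1
      refine Submodule.span_mono ?_ h1
      intro m hm
      obtain ⟨l, hl, rfl⟩ := Submonoid.exists_list_of_mem_closure hm
      have : l ∈ Set.range (List.map e) := by
        rw [Set.range_list_map]
        exact hl
      obtain ⟨l', rfl⟩ := this
      exact ⟨l', by simp, rfl⟩
    | insert j t hj ih =>
      let P : A →ₗ[ℝ] A := LinearMap.id + s j • (LinearMap.mulLeft ℝ (e j) ∘ₗ LinearMap.mulRight ℝ (e j))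
      have hP : ∀ y, P y = y + s j • (e j * (y * e j)) := fun y => by simp [P]
      have hPx : P x = (2 : ℝ) • x := by
        rw [hP, ← hx j, ← mul_assoc, hsq, smul_mul_assoc, one_mul, smul_smul, hs, one_smul,
          two_smul]
      have hmem : ∀ y ∈ Submodule.span ℝ
          {m : A | ∃ l : List ι, (∀ i ∈ t, Even (l.length + l.count i)) ∧ m = (l.map e).prod},
          P y ∈ Submodule.span ℝ {m : A | ∃ l : List ι,
            (∀ i ∈ insert j t, Even (l.length + l.count i)) ∧ m = (l.map e).prod} := by
        intro y hy
        induction hy using Submodule.span_induction with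
        | zero => simp
        | add a b _ _ ha hb => rw [map_add]; exact Submodule.add_mem _ ha hb
        | smul c a _ ha => rw [map_smul]; exact Submodule.smul_mem _ _ ha
        | mem m hm =>
          obtain ⟨l, hl, rfl⟩ := hm
          have hcm := gen_mul_word e hac j l
          have h3 : P (l.map e).prod = (1 + (-1 : ℝ) ^ (l.length + l.count j)) • (l.map e).prod := by
            rw [hP, ← mul_assoc, hcm, smul_mul_assoc, mul_assoc, hsq, mul_smul_comm, mul_one,
              smul_smul, smul_smul, add_smul, one_smul]
            congr 2
            linear_combination (-1 : ℝ) ^ (l.length + l.count j) * hs j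
          rw [h3]
          rcases Nat.even_or_odd (l.length + l.count j) with he | ho
          · apply Submodule.smul_mem
            apply Submodule.subset_span
            refine ⟨l, ?_, rfl⟩
            intro i hi
            rcases Finset.mem_insert.1 hi with rfl | hi
            · exact he
            · exact hl i hi
          · rw [ho.neg_one_pow]
            simp
      have h4 := hmem x ih
      rw [hPx] at h4
      have h5 := Submodule.smul_mem _ (2⁻¹ : ℝ) h4
      rwa [smul_smul, inv_mul_cancel₀ two_ne_zero, one_smul] at h5
  have h6 := key Finset.univ
  have h7 : x ∈ Submodule.span ℝ {(1 : A)} := by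
    refine Submodule.span_le.2 ?_ h6
    rintro m ⟨l, hl, rfl⟩
    obtain ⟨c, hc⟩ := word_central e s hsq hac hcard l (fun i => hl i (Finset.mem_univ i))
    rw [hc]
    exact Submodule.smul_mem _ _ (Submodule.mem_span_singleton_self _)
  obtain ⟨c, hc⟩ := Submodule.mem_span_singleton.1 h7
  exact ⟨c, hc.symm⟩

/-- Existence of a nonzero intertwiner inside a set closed under the relevant operations. -/
lemma exists_intertwiner (e f : ι → A) (s : ι → ℝ) (hs : ∀ i, s i * s i = 1)
    (hsq : ∀ i, e i * e i = s i • (1 : A))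
    (hac : ∀ i j, i ≠ j → e i * e j = -(e j * e i))
    (hfsq : ∀ i, f i * f i = s i • (1 : A))
    (hfac : ∀ i j, i ≠ j → f i * f j = -(f j * f i)) (hcard : Even (Fintype.card ι))
    (I : Submodule ℝ A) (hL : ∀ a, ∀ x ∈ I, a * x ∈ I) (hR : ∀ a, ∀ x ∈ I, x * a ∈ I)
    (u₀ : A) (hu₀ : u₀ ∈ I) (hne : u₀ ≠ 0) :
    ∃ u ∈ I, u ≠ 0 ∧ ∀ i, f i * u = u * e i := by
  have key : ∀ t : Finset ι, ∃ u ∈ I, u ≠ 0 ∧ ∀ i ∈ t, f i * u = u * e i := by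
    intro t
    induction t using Finset.induction_on with
    | empty => exact ⟨u₀, hu₀, hne, by simp⟩
    | insert j t hj ih =>
      obtain ⟨u, huI, hu0, hu⟩ := ih
      by_cases hz : u + s j • (f j * u * e j) = 0
      · have hanti : f j * u = -(u * e j) := by
          have h1 : f j * (u + s j • (f j * u * e j)) = 0 := by rw [hz, mul_zero]
          rw [mul_add, mul_smul_comm, ← mul_assoc, ← mul_assoc, hfsq, smul_mul_assoc, one_mul,
            smul_mul_assoc, smul_smul, hs, one_smul] at h1
          exact eq_neg_of_add_eq_zero_left h1
        set l := (Finset.univ.erase j).toList with hl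
        have hlen : l.length + 1 = Fintype.card ι := by
          rw [hl, Finset.length_toList, Finset.card_erase_add_one (Finset.mem_univ j)]
          rfl
        have hcj : l.count j = 0 := by
          rw [List.count_eq_zero, hl]
          simp
        have hci : ∀ i, i ≠ j → l.count i = 1 := by
          intro i hi
          apply List.count_eq_one_of_mem (Finset.nodup_toList _)
          simp [hi]
        have hunit : IsUnit (l.map e).prod := by
          apply List.prod_isUnit
          intro m hm
          obtain ⟨i, _, rfl⟩ := List.mem_map.1 hm
          refine ⟨⟨e i, s i • e i, ?_, ?_⟩, rfl⟩
          · rw [mul_smul_comm, hsq, smul_smul, hs, one_smul]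
          · rw [smul_mul_assoc, hsq, smul_smul, hs, one_smul]
        refine ⟨u * (l.map e).prod, hR _ _ huI, ?_, ?_⟩
        · intro h0
          exact hu0 ((hunit.mul_left_eq_zero).1 h0)
        · intro i hi
          have hg := gen_mul_word e hac i l
          rcases Finset.mem_insert.1 hi with rfl | hi
          · have hodd : Odd (l.length + l.count i) := by
              rw [hcj, add_zero]
              rw [← hlen, Nat.even_add_one] at hcard
              exact Nat.not_even_iff_odd.1 hcard
            rw [hodd.neg_one_pow] at hg
            rw [← mul_assoc, hanti, neg_mul, mul_assoc, hg]
            simp [mul_assoc]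
          · have hij : i ≠ j := fun h => hj (h ▸ hi)
            rw [hci i hij, hlen, hcard.neg_one_pow, one_smul] at hg
            rw [← mul_assoc, hu i hi, mul_assoc, hg, mul_assoc]
      · refine ⟨_, I.add_mem huI (I.smul_mem (s j) (hR (e j) _ (hL (f j) _ huI))), hz, ?_⟩
        intro i hi
        rcases Finset.mem_insert.1 hi with rfl | hi
        · rw [mul_add, mul_smul_comm, ← mul_assoc, ← mul_assoc, hfsq, smul_mul_assoc, one_mul,
            smul_mul_assoc, smul_smul, hs, one_smul, add_mul, smul_mul_assoc, mul_assoc (f i * u),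
            hsq, mul_smul_comm, mul_one, smul_smul, hs, one_smul, add_comm]
        · have hij : i ≠ j := fun h => hj (h ▸ hi)
          have h8 : f i * (f j * u * e j) = f j * u * e j * e i := by
            rw [← mul_assoc, ← mul_assoc, hfac i j hij, neg_mul, mul_assoc (f j), hu i hi,
              ← mul_assoc, neg_mul, mul_assoc (f j * u), hac i j hij]
            simp [mul_assoc]
          rw [mul_add, mul_smul_comm, h8, hu i hi, add_mul, smul_mul_assoc]
  obtain ⟨u, h1, h2, h3⟩ := key Finset.univ
  exact ⟨u, h1, h2, fun i => h3 i (Finset.mem_univ i)⟩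

/-- Automorphisms are inner. -/
lemma aut_inner_aux [Nontrivial A] (e : ι → A) (s : ι → ℝ) (hs : ∀ i, s i * s i = 1)
    (hsq : ∀ i, e i * e i = s i • (1 : A))
    (hac : ∀ i j, i ≠ j → e i * e j = -(e j * e i)) (hcard : Even (Fintype.card ι))
    (hgen : Algebra.adjoin ℝ (Set.range e) = ⊤) (φ : A ≃ₐ[ℝ] A) :
    ∃ u : Aˣ, ∀ x : A, φ x = ↑u * x * ↑u⁻¹ := by
  obtain ⟨u, -, hu0, hu⟩ := exists_intertwiner e (fun i => φ (e i)) s hs hsq hac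
    (fun i => by rw [← map_mul, hsq, map_smul, map_one])
    (fun i j hij => by rw [← map_mul, hac i j hij, map_neg, map_mul]) hcard
    ⊤ (by simp) (by simp) 1 trivial one_ne_zero
  have hint : ∀ x, φ x * u = u * x := by
    intro x
    have hx : x ∈ Algebra.adjoin ℝ (Set.range e) := by rw [hgen]; trivial
    induction hx using Algebra.adjoin_induction with
    | mem y hy => obtain ⟨i, rfl⟩ := hy; exact hu i
    | algebraMap r => rw [AlgEquiv.commutes]; exact Algebra.commutes r u
    | add a b _ _ ha hb => rw [map_add, add_mul, mul_add, ha, hb]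
    | mul a b _ _ ha hb => rw [map_mul, mul_assoc, hb, ← mul_assoc, ha, mul_assoc]
  have hint' : ∀ x, u * φ.symm x = x * u := by
    intro x
    rw [← hint, AlgEquiv.apply_symm_apply]
  obtain ⟨z, hzI, hz0, hz⟩ := exists_intertwiner e e s hs hsq hac hsq hac hcard
    (LinearMap.range (LinearMap.mulLeft ℝ u))
    (by
      rintro a _ ⟨x, rfl⟩
      exact ⟨φ.symm a * x, by simp [← mul_assoc, hint']⟩)
    (by
      rintro a _ ⟨x, rfl⟩
      exact ⟨x * a, by simp [mul_assoc]⟩) u ⟨1, by simp⟩ hu0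
  obtain ⟨c, rfl⟩ := central_scalar e s hs hsq hac hcard hgen z hz
  have hc : c ≠ 0 := by
    rintro rfl
    simp at hz0
  obtain ⟨v, hv⟩ := hzI
  rw [LinearMap.mulLeft_apply] at hv
  have h1 : u * (c⁻¹ • v) = 1 := by
    rw [mul_smul_comm, hv, smul_smul, inv_mul_cancel₀ hc, one_smul]
  have h2 : φ (c⁻¹ • v) * u = 1 := by rw [hint, h1]
  have h3 : φ (c⁻¹ • v) = c⁻¹ • v := left_inv_eq_right_inv h2 h1
  rw [h3] at h2
  refine ⟨⟨u, c⁻¹ • v, h1, h2⟩, fun x => ?_⟩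
  change φ x = u * x * (c⁻¹ • v)
  rw [← hint, mul_assoc, h1, mul_one]

end Helper

/-- Every `ℝ`-algebra automorphism of a real Clifford algebra of even rank is inner. -/
theorem real_clifford_aut_inner (p q : ℕ) (h : Even (p + q))
    (φ : RealCliffordAlgebra p q ≃ₐ[ℝ] RealCliffordAlgebra p q) :
    ∃ u : (RealCliffordAlgebra p q)ˣ,
      ∀ x : RealCliffordAlgebra p q, φ x = ↑u * x * ↑u⁻¹ := by
  letI : Invertible (2 : ℝ) := invertibleOfNonzero two_ne_zero
  have : Nontrivial (RealCliffordAlgebra p q) := inferInstance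
  refine aut_inner_aux (fun i : Fin (p + q) => CliffordAlgebra.ι (Qpq p q) (Pi.single i 1))
    (fun i => if (i : ℕ) < p then (1 : ℝ) else -1) (fun i => by split_ifs <;> simp)
    (fun i => ?_) (fun i j hij => ?_) (by simpa using h) ?_ φ
  · rw [CliffordAlgebra.ι_sq_scalar, Algebra.algebraMap_eq_smul_one]
    congr 1
    simp only [Qpq, QuadraticMap.weightedSumSquares_apply]
    rw [Finset.sum_eq_single i]
    · simp
    · intro j _ hj
      simp [Pi.single_apply, hj]
    · simp
  · apply eq_neg_of_add_eq_zero_left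
    apply CliffordAlgebra.ι_mul_ι_add_swap_of_isOrtho
    rw [QuadraticMap.isOrtho_def]
    simp only [Qpq, QuadraticMap.weightedSumSquares_apply, ← Finset.sum_add_distrib]
    apply Finset.sum_congr rfl
    intro k _
    by_cases h1 : k = i
    · have h2 : k ≠ j := fun h => hij (h1 ▸ h)
      simp [Pi.single_apply, h1, h2, hij]
    · simp [Pi.single_apply, h1]
  · rw [eq_top_iff, ← CliffordAlgebra.adjoin_range_ι]
    apply Algebra.adjoin_le
    rintro _ ⟨v, rfl⟩
    rw [pi_eq_sum_univ' v, map_sum]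
    apply Subalgebra.sum_mem
    intro i _
    rw [map_smul]
    apply Subalgebra.smul_mem
    apply Algebra.subset_adjoin
    refine ⟨i, ?_⟩
    simp only
end

section
/- Uniqueness of the irreducible representation of a real Clifford algebra of even rank: for all natural numbers p and q with p + q even, any two simple modules over the real Clifford algebra C(p,q) are isomorphic as C(p,q)-modules. -/
/-- A product of pairwise anticommuting elements commutes up to sign with each generator. -/
theorem clifford_list_prod_comm {A ι : Type*} [Ring A] (e : ι → A)
    (hanti : ∀ i j, i ≠ j → e i * e j = -(e j * e i)) (k : ι) (l : List ι) (hl : l.Nodup) :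
    (k ∉ l → (l.map e).prod * e k = (-1) ^ l.length * (e k * (l.map e).prod)) ∧
    (k ∈ l → (l.map e).prod * e k = (-1) ^ (l.length + 1) * (e k * (l.map e).prod)) := by
  induction l with
  | nil => simp
  | cons a l ih =>
    obtain ⟨ha, hl⟩ := List.nodup_cons.mp hl
    obtain ⟨ih1, ih2⟩ := ih hl
    have hc : ∀ n : ℕ, ∀ x : A, x * (-1) ^ n = (-1) ^ n * x := fun n x =>
      ((Commute.neg_one_right x).pow_right n).eq
    constructor
    · intro hk
      have hka : k ≠ a := fun hh => hk (by simp [hh])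
      have hkl : k ∉ l := fun hh => hk (by simp [hh])
      simp only [List.map_cons, List.prod_cons, List.length_cons]
      rw [mul_assoc, ih1 hkl, ← mul_assoc, hc, mul_assoc, ← mul_assoc (e a),
        hanti a k (Ne.symm hka), pow_succ]
      simp [mul_assoc]
    · intro hk
      simp only [List.map_cons, List.prod_cons, List.length_cons]
      by_cases hka : k = a
      · subst hka
        rw [mul_assoc, ih1 ha, ← mul_assoc, hc, mul_assoc, pow_succ, pow_succ]
        simp
      · have hkl : k ∈ l := (List.mem_cons.mp hk).resolve_left hka
        rw [mul_assoc, ih2 hkl, ← mul_assoc, hc, mul_assoc, ← mul_assoc (e a),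
          hanti a k (Ne.symm hka), pow_succ _ (l.length + 1)]
        simp [mul_assoc]

/-- Existence of a nonzero map fixed by all the twisted conjugations. -/
theorem clifford_exists_fixed {A M N : Type*} [Ring A] [Algebra ℝ A]
    [AddCommGroup M] [AddCommGroup N] [Module ℝ M] [Module ℝ N] [Module A M] [Module A N]
    [IsScalarTower ℝ A M] [IsScalarTower ℝ A N] [Nontrivial M] [Nontrivial N]
    (n : ℕ) (hn : Even n) (e : Fin n → A) (w : Fin n → ℝ) (hw : ∀ i, w i * w i = 1)
    (hsq : ∀ i, e i * e i = algebraMap ℝ A (w i))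
    (hanti : ∀ i j, i ≠ j → e i * e j = -(e j * e i)) (s : Finset (Fin n)) :
    ∃ f : M →ₗ[ℝ] N, f ≠ 0 ∧ ∀ i ∈ s, ∀ x, f (e i • x) = e i • f x := by
  have hM : ∀ i (x : M), e i • e i • x = w i • x := fun i x => by
    rw [← mul_smul, hsq, algebraMap_smul]
  have hN : ∀ i (x : N), e i • e i • x = w i • x := fun i x => by
    rw [← mul_smul, hsq, algebraMap_smul]
  have hcN : ∀ i (r : ℝ) (x : N), e i • r • x = r • e i • x := fun i r x => by
    rw [← algebraMap_smul A r x, ← algebraMap_smul A r (e i • x), ← mul_smul, ← mul_smul,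
      Algebra.commutes]
  have hcM : ∀ (a : A) (r : ℝ) (x : M), a • r • x = r • a • x := fun a r x => by
    rw [← algebraMap_smul A r x, ← algebraMap_smul A r (a • x), ← mul_smul, ← mul_smul,
      Algebra.commutes]
  have hu : ∀ i, IsUnit (e i) := fun i => by
    have h1 : e i * (e i * algebraMap ℝ A (w i)) = 1 := by
      rw [← mul_assoc, hsq, ← map_mul, hw, map_one]
    have h2 : (e i * algebraMap ℝ A (w i)) * e i = 1 := by
      rw [mul_assoc, Algebra.commutes, ← mul_assoc, hsq, ← map_mul, hw, map_one]
    exact ⟨⟨_, _, h1, h2⟩, rfl⟩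
  induction s using Finset.induction_on with
  | empty =>
    obtain ⟨f, hf⟩ := exists_ne (0 : M →ₗ[ℝ] N)
    exact ⟨f, hf, by simp⟩
  | insert i s hi ih =>
    obtain ⟨f, hf, hfs⟩ := ih
    let g : M →ₗ[ℝ] N :=
      { toFun := fun x => f x + w i • e i • f (e i • x)
        map_add' := fun x y => by simp only [smul_add, map_add]; abel
        map_smul' := fun r x => by
          simp only [hcM, map_smul, hcN, smul_add, RingHom.id_apply]
          rw [smul_comm (w i) r] }
    have hg : ∀ x, g x = f x + w i • e i • f (e i • x) := fun _ => rfl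
    by_cases hg0 : g = 0
    · have hfi : ∀ x, f (e i • x) = -(e i • f x) := fun x => by
        have h0 : g x = 0 := by rw [hg0]; rfl
        rw [hg] at h0
        have h1 := congrArg (fun y => e i • y) h0
        simp only [smul_add, hcN, hN, smul_smul, hw, one_smul, smul_zero] at h1
        exact (neg_eq_of_add_eq_zero_right h1).symm
      let l := (Finset.univ.erase i).toList
      let c := (l.map e).prod
      have hl : l.Nodup := Finset.nodup_toList _
      have hlen : l.length + 1 = n := by
        have := Finset.card_erase_add_one (Finset.mem_univ i)
        simpa [l] using this
      have hlo : Odd l.length := by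
        rw [← hlen] at hn
        exact Nat.not_even_iff_odd.mp (Nat.even_add_one.mp hn)
      have hci : c * e i = -(e i * c) := by
        have := (clifford_list_prod_comm e hanti i l hl).1 (by simp [l])
        rwa [hlo.neg_one_pow, neg_one_mul] at this
      have hcj : ∀ j, j ≠ i → c * e j = e j * c := fun j hj => by
        have := (clifford_list_prod_comm e hanti j l hl).2 (by simp [l, hj])
        rwa [hlo.add_one.neg_one_pow, one_mul] at this
      have hcu : IsUnit c := by
        have : ∀ l : List (Fin n), IsUnit (l.map e).prod := fun l => by
          induction l with
          | nil => simp
          | cons a l ih => simpa using (hu a).mul ih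
        exact this l
      let k : M →ₗ[ℝ] N :=
        { toFun := fun x => f (c • x)
          map_add' := fun x y => by simp only [smul_add, map_add]
          map_smul' := fun r x => by simp only [hcM, map_smul, RingHom.id_apply] }
      have hk : ∀ x, k x = f (c • x) := fun _ => rfl
      refine ⟨k, ?_, ?_⟩
      · intro h0
        apply hf
        ext x
        obtain ⟨u, huc⟩ := hcu
        have : k ((↑u⁻¹ : A) • x) = 0 := by rw [h0]; rfl
        rw [hk, ← huc, ← mul_smul, Units.mul_inv, one_smul] at this
        simpa using this
      · intro j hj x
        rw [hk, hk, ← mul_smul]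
        by_cases hji : j = i
        · subst hji
          rw [hci, neg_smul, map_neg, mul_smul, hfi, neg_neg]
        · rw [hcj j hji, mul_smul, hfs j (Finset.mem_of_mem_insert_of_ne hj hji)]
    · refine ⟨g, hg0, ?_⟩
      intro j hj x
      rw [hg, hg]
      by_cases hji : j = i
      · subst hji
        simp only [hM, map_smul, smul_add, hcN, hN, smul_smul, hw, one_smul]
        abel
      · have hjs := hfs j (Finset.mem_of_mem_insert_of_ne hj hji)
        rw [hjs, smul_add, hcN, ← mul_smul (e i) (e j) x, hanti i j (Ne.symm hji), neg_smul,
          mul_smul, map_neg, hjs, smul_neg, ← mul_smul (e i) (e j), hanti i j (Ne.symm hji),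
          neg_smul, neg_neg, mul_smul]


/-- For `p + q` even, any two simple modules over `C(p,q)` are isomorphic. -/
theorem real_clifford_simple_module_unique (p q : ℕ) (h : Even (p + q))
    (M N : Type) [AddCommGroup M] [Module (RealCliffordAlgebra p q) M]
    [AddCommGroup N] [Module (RealCliffordAlgebra p q) N]
    (hM : IsSimpleModule (RealCliffordAlgebra p q) M)
    (hN : IsSimpleModule (RealCliffordAlgebra p q) N) :
    Nonempty (M ≃ₗ[RealCliffordAlgebra p q] N) := by

  classical
  letI : Module ℝ M := Module.compHom M (algebraMap ℝ (RealCliffordAlgebra p q))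
  letI : Module ℝ N := Module.compHom N (algebraMap ℝ (RealCliffordAlgebra p q))
  haveI : IsScalarTower ℝ (RealCliffordAlgebra p q) M :=
    ⟨fun r a x => by rw [Algebra.smul_def, mul_smul]; rfl⟩
  haveI : IsScalarTower ℝ (RealCliffordAlgebra p q) N :=
    ⟨fun r a x => by rw [Algebra.smul_def, mul_smul]; rfl⟩
  haveI : Nontrivial M := IsSimpleModule.nontrivial (RealCliffordAlgebra p q) M
  haveI : Nontrivial N := IsSimpleModule.nontrivial (RealCliffordAlgebra p q) N
  let w : Fin (p + q) → ℝ := fun i => if (i : ℕ) < p then (1 : ℝ) else -1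
  let e : Fin (p + q) → RealCliffordAlgebra p q := fun i =>
    CliffordAlgebra.ι (Qpq p q) (Pi.single i 1)
  have hQ : ∀ v, Qpq p q v = ∑ i, w i * (v i * v i) := fun v => by
    simp [Qpq, QuadraticMap.weightedSumSquares_apply, w]
  obtain ⟨f, hf0, hf⟩ := clifford_exists_fixed (M := M) (N := N) (p + q) h e w
    (fun i => by simp only [w]; split_ifs <;> norm_num)
    (fun i => by
      simp only [e]
      rw [CliffordAlgebra.ι_sq_scalar, hQ]
      congr 1
      simp [Pi.single_apply])
    (fun i j hij => by
      simp only [e]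
      apply CliffordAlgebra.ι_mul_ι_comm_of_isOrtho
      rw [QuadraticMap.isOrtho_def, hQ, hQ, hQ, ← Finset.sum_add_distrib]
      refine Finset.sum_congr rfl fun k _ => ?_
      by_cases h1 : k = i
      · subst h1
        simp [Pi.single_apply, hij]
      · simp [Pi.single_apply, h1]) Finset.univ
  have hι : ∀ v x, f (CliffordAlgebra.ι (Qpq p q) v • x) =
      CliffordAlgebra.ι (Qpq p q) v • f x := fun v x => by
    have hv : CliffordAlgebra.ι (Qpq p q) v = ∑ i, v i • e i := by
      conv_lhs => rw [pi_eq_sum_univ' v]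
      simp only [map_sum, map_smul, e]
    rw [hv, Finset.sum_smul, Finset.sum_smul, map_sum]
    refine Finset.sum_congr rfl fun i _ => ?_
    rw [smul_assoc, smul_assoc, map_smul, hf i (Finset.mem_univ i)]
  have hall : ∀ (a : RealCliffordAlgebra p q) x, f (a • x) = a • f x := fun a => by
    induction a using CliffordAlgebra.induction with
    | algebraMap r => intro x; rw [algebraMap_smul, algebraMap_smul, map_smul]
    | ι v => exact hι v
    | mul a b ha hb => intro x; rw [mul_smul, ha, hb, mul_smul]
    | add a b ha hb => intro x; rw [add_smul, map_add, ha, hb, add_smul]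
  let F : M →ₗ[RealCliffordAlgebra p q] N :=
    { toFun := f, map_add' := f.map_add, map_smul' := hall }
  have hF : F ≠ 0 := fun h0 => hf0 (by
    ext x
    exact congrArg (fun G : M →ₗ[RealCliffordAlgebra p q] N => G x) h0)
  exact ⟨LinearEquiv.ofBijective F (LinearMap.bijective_of_ne_zero hF)⟩
end

section
/- Uniqueness of the irreducible representation of a complex Clifford algebra of even rank: for every even natural number n, any two simple modules over the complex Clifford algebra ℂCl(n) are isomorphic as ℂCl(n)-modules. -/
section CAR

variable {A : Type*} [Ring A] [Algebra ℂ A]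

lemma car_list_left {k : ℕ} (u q : Fin k → A)
    (hc : ∀ i j, i ≠ j → u j * q i = q i * u j) (h0 : ∀ j, u j * q j = 0)
    (l : List (Fin k)) (j : Fin k) (hj : j ∈ l) : u j * (l.map q).prod = 0 := by
  induction l with
  | nil => simp at hj
  | cons i l ih =>
    rw [List.map_cons, List.prod_cons, ← mul_assoc]
    by_cases h : i = j
    · subst h; rw [h0, zero_mul]
    · have : j ∈ l := by
        rcases List.mem_cons.1 hj with h' | h'
        · exact absurd h'.symm h
        · exact h'
      rw [hc i j h, mul_assoc, ih this, mul_zero]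

lemma car_list_right {k : ℕ} (v q : Fin k → A)
    (hc : ∀ i j, i ≠ j → v j * q i = q i * v j) (h0 : ∀ j, q j * v j = 0)
    (l : List (Fin k)) (j : Fin k) (hj : j ∈ l) : (l.map q).prod * v j = 0 := by
  induction l with
  | nil => simp at hj
  | cons i l ih =>
    rw [List.map_cons, List.prod_cons, mul_assoc]
    by_cases h : j ∈ l
    · rw [ih h, mul_zero]
    · have hij : j = i := by
        rcases List.mem_cons.1 hj with h' | h'
        · exact h'
        · exact absurd h' h
      have : Commute (v j) (l.map q).prod := by
        apply Commute.list_prod_right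
        intro x hx
        obtain ⟨i', hi', rfl⟩ := List.mem_map.1 hx
        exact hc i' j (fun e => h (e ▸ hi'))
      rw [← this.eq, ← mul_assoc, hij, h0, zero_mul]

/-- existence of an element `p` with `p A p ⊆ ℂ p` fixing a nonzero vector in each nonzero module -/
lemma car_exists {k : ℕ} (u v : Fin k → A)
    (huu : ∀ i j, u i * u j + u j * u i = 0) (hvv : ∀ i j, v i * v j + v j * v i = 0)
    (huv : ∀ i j, u i * v j + v j * u i = if i = j then 1 else 0)
    (hu2 : ∀ i, u i * u i = 0) (hv2 : ∀ i, v i * v i = 0)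
    (hgen : ∀ T : Submodule ℂ A, 1 ∈ T → (∀ j, ∀ x ∈ T, u j * x ∈ T) →
      (∀ j, ∀ x ∈ T, v j * x ∈ T) → T = ⊤) :
    ∃ p : A, (∀ a, ∃ c : ℂ, p * a * p = algebraMap ℂ A c * p) ∧
      ∀ (M : Type) [AddCommGroup M] [Module A M], Nontrivial M → ∃ m : M, m ≠ 0 ∧ p • m = m := by
  classical
  set q : Fin k → A := fun j => u j * v j with hq
  have huv' : ∀ i j, i ≠ j → u i * v j = - (v j * u i) := fun i j h => by
    have := huv i j; rw [if_neg h] at this; exact eq_neg_of_add_eq_zero_left this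
  have huu' : ∀ i j, u i * u j = - (u j * u i) := fun i j => eq_neg_of_add_eq_zero_left (huu i j)
  have hvv' : ∀ i j, v i * v j = - (v j * v i) := fun i j => eq_neg_of_add_eq_zero_left (hvv i j)
  have huv1 : ∀ i, u i * v i = 1 - v i * u i := fun i => by
    have := huv i i; rw [if_pos rfl] at this; exact eq_sub_of_add_eq this
  set p : A := ((List.finRange k).map q).prod with hp
  have hup : ∀ j, u j * p = 0 := fun j => by
    refine car_list_left u q ?_ ?_ _ j (List.mem_finRange j)
    · intro i j h
      simp only [hq]
      rw [← mul_assoc, huu' j i, neg_mul, mul_assoc, huv' j i h.symm, mul_neg, neg_neg, mul_assoc]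
    · intro j
      simp only [hq]
      rw [← mul_assoc, hu2, zero_mul]
  have hpv : ∀ j, p * v j = 0 := fun j => by
    refine car_list_right v q ?_ ?_ _ j (List.mem_finRange j)
    · intro i j h
      simp only [hq]
      have := huv' i j h
      rw [← mul_assoc, mul_assoc (u i), hvv' i j, mul_neg, ← mul_assoc, this, neg_mul, neg_neg]
    · intro j
      simp only [hq]
      rw [mul_assoc, hv2, mul_zero]
  set LV := Algebra.adjoin ℂ (Set.range v) with hLV
  set LU := Algebra.adjoin ℂ (Set.range u) with hLU
  have hpx : ∀ x ∈ LV, ∃ c : ℂ, p * x = algebraMap ℂ A c * p := by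
    intro x hx
    induction hx using Algebra.adjoin_induction with
    | mem x hx => obtain ⟨j, rfl⟩ := hx; exact ⟨0, by simp [hpv]⟩
    | algebraMap r => exact ⟨r, (Algebra.commutes r p).symm⟩
    | add x y _ _ h1 h2 =>
      obtain ⟨c, hc⟩ := h1; obtain ⟨d, hd⟩ := h2
      exact ⟨c + d, by rw [mul_add, hc, hd, map_add, add_mul]⟩
    | mul x y _ _ h1 h2 =>
      obtain ⟨c, hc⟩ := h1; obtain ⟨d, hd⟩ := h2
      exact ⟨c * d, by rw [← mul_assoc, hc, mul_assoc, hd, map_mul, mul_assoc]⟩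
  have hyp : ∀ x ∈ LU, ∃ c : ℂ, x * p = algebraMap ℂ A c * p := by
    intro x hx
    induction hx using Algebra.adjoin_induction with
    | mem x hx => obtain ⟨j, rfl⟩ := hx; exact ⟨0, by simp [hup]⟩
    | algebraMap r => exact ⟨r, rfl⟩
    | add x y _ _ h1 h2 =>
      obtain ⟨c, hc⟩ := h1; obtain ⟨d, hd⟩ := h2
      exact ⟨c + d, by rw [add_mul, hc, hd, map_add, add_mul]⟩
    | mul x y _ _ h1 h2 =>
      obtain ⟨c, hc⟩ := h1; obtain ⟨d, hd⟩ := h2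
      exact ⟨d * c, by rw [mul_assoc, hd, ← mul_assoc, ← Algebra.commutes, mul_assoc, hc, map_mul,
        mul_assoc]⟩
  have hux : ∀ j, ∀ x ∈ LV, ∃ x1 ∈ LV, ∃ x2 ∈ LV, u j * x = x1 + x2 * u j := by
    intro j x hx
    induction hx using Algebra.adjoin_induction with
    | mem x hx =>
      obtain ⟨i, rfl⟩ := hx
      have hvi : v i ∈ LV := Algebra.subset_adjoin ⟨i, rfl⟩
      refine ⟨if j = i then 1 else 0, ?_, - v i, neg_mem hvi, ?_⟩
      · split_ifs
        · exact one_mem _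
        · exact zero_mem _
      · rw [← huv j i, neg_mul, add_neg_cancel_right]
    | algebraMap r =>
      exact ⟨0, zero_mem _, algebraMap ℂ A r, LV.algebraMap_mem r, by
        rw [zero_add, Algebra.commutes]⟩
    | add x y _ _ h1 h2 =>
      obtain ⟨a, ha, b, hb, h⟩ := h1; obtain ⟨c, hc, d, hd, h'⟩ := h2
      exact ⟨a + c, add_mem ha hc, b + d, add_mem hb hd, by rw [mul_add, h, h', add_mul]; abel⟩
    | mul x y hx hy h1 h2 =>
      obtain ⟨a, ha, b, hb, h⟩ := h1; obtain ⟨c, hc, d, hd, h'⟩ := h2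
      exact ⟨a * y + b * c, add_mem (mul_mem ha hy) (mul_mem hb hc), b * d, mul_mem hb hd, by
        rw [← mul_assoc, h, add_mul, mul_assoc, h', mul_add, ← mul_assoc, add_assoc]⟩
  have hT : Subalgebra.toSubmodule LV * Subalgebra.toSubmodule LU = ⊤ := by
    apply hgen
    · have := Submodule.mul_mem_mul (M := Subalgebra.toSubmodule LV)
        (N := Subalgebra.toSubmodule LU) (one_mem LV) (one_mem LU)
      simpa using this
    · intro j x hx
      induction hx using Submodule.mul_induction_on' with
      | mem_mul_mem x hx y hy =>
        obtain ⟨a, ha, b, hb, h⟩ := hux j x hx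
        rw [← mul_assoc, h, add_mul, mul_assoc b]
        exact add_mem (Submodule.mul_mem_mul ha hy)
          (Submodule.mul_mem_mul hb (LU.mul_mem (Algebra.subset_adjoin ⟨j, rfl⟩ : u j ∈ LU) hy))
      | add x _ y _ h1 h2 => rw [mul_add]; exact add_mem h1 h2
    · intro j x hx
      induction hx using Submodule.mul_induction_on' with
      | mem_mul_mem x hx y hy =>
        rw [← mul_assoc]
        exact Submodule.mul_mem_mul (LV.mul_mem (Algebra.subset_adjoin ⟨j, rfl⟩ : v j ∈ LV) hx) hy
      | add x _ y _ h1 h2 => rw [mul_add]; exact add_mem h1 h2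
  refine ⟨p, ?_, ?_⟩
  · intro a
    have ha : a ∈ Subalgebra.toSubmodule LV * Subalgebra.toSubmodule LU := hT ▸ Submodule.mem_top
    induction ha using Submodule.mul_induction_on' with
    | mem_mul_mem x hx y hy =>
      obtain ⟨c, hc⟩ := hpx x hx
      obtain ⟨d, hd⟩ := hyp y hy
      have hpp : p * p = p := by
        have : ∀ l : List (Fin k), (l.map q).prod * p = p := by
          intro l
          induction l with
          | nil => simp
          | cons i l ih =>
            rw [List.map_cons, List.prod_cons, mul_assoc, ih]
            simp only [hq]
            rw [huv1, sub_mul, one_mul, mul_assoc, hup, mul_zero, sub_zero]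
        exact this _
      exact ⟨c * d, by
        rw [← mul_assoc, hc, mul_assoc, mul_assoc, hd, ← mul_assoc p, ← Algebra.commutes,
          mul_assoc _ p p, hpp, map_mul, mul_assoc]⟩
    | add x _ y _ h1 h2 =>
      obtain ⟨c, hc⟩ := h1; obtain ⟨d, hd⟩ := h2
      exact ⟨c + d, by rw [mul_add, add_mul, hc, hd, map_add, add_mul]⟩
  · intro M _ _ hM
    have hvac : ∀ l : List (Fin k), ∃ m : M, m ≠ 0 ∧ ∀ i ∈ l, u i • m = 0 := by
      intro l
      induction l with
      | nil => obtain ⟨m, hm⟩ := exists_ne (0 : M); exact ⟨m, hm, by simp⟩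
      | cons j l ih =>
        obtain ⟨m, hm, h⟩ := ih
        by_cases h0 : u j • m = 0
        · exact ⟨m, hm, by simpa using ⟨h0, h⟩⟩
        · refine ⟨u j • m, h0, fun i hi => ?_⟩
          rcases List.mem_cons.1 hi with rfl | hi
          · rw [smul_smul, hu2, zero_smul]
          · rw [smul_smul, huu', neg_smul, mul_smul, h i hi, smul_zero, neg_zero]
    obtain ⟨m, hm, h⟩ := hvac (List.finRange k)
    refine ⟨m, hm, ?_⟩
    have : ∀ l : List (Fin k), (l.map q).prod • m = m := by
      intro l
      induction l with
      | nil => simp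
      | cons i l ih =>
        rw [List.map_cons, List.prod_cons, mul_smul, ih]
        simp only [hq]
        rw [huv1, sub_smul, one_smul, mul_smul, h i (List.mem_finRange i), smul_zero, sub_zero]
    exact this _

lemma car_ker (p : A) (hp : ∀ a, ∃ c : ℂ, p * a * p = algebraMap ℂ A c * p)
    (M : Type) [AddCommGroup M] [Module A M] [IsSimpleModule A M] (m : M) (hm : m ≠ 0)
    (hpm : p • m = m) (a : A) :
    a ∈ LinearMap.ker (LinearMap.toSpanSingleton A M m) ↔ ∀ b, p * (b * a) * p = 0 := by
  rw [LinearMap.mem_ker, LinearMap.toSpanSingleton_apply]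
  constructor
  · intro h b
    obtain ⟨c, hc⟩ := hp (b * a)
    have h1 : (p * (b * a) * p) • m = 0 := by
      rw [mul_smul, hpm, mul_smul, mul_smul, h, smul_zero, smul_zero]
    by_cases hc0 : c = 0
    · rw [hc, hc0, map_zero, zero_mul]
    · exfalso
      rw [hc, mul_smul, hpm] at h1
      apply hm
      have : algebraMap ℂ A c⁻¹ • algebraMap ℂ A c • m = 0 := by rw [h1, smul_zero]
      rwa [smul_smul, ← map_mul, inv_mul_cancel₀ hc0, map_one, one_smul] at this
  · intro h
    by_contra h0
    obtain ⟨b, hb⟩ := IsSimpleModule.toSpanSingleton_surjective A h0 m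
    rw [LinearMap.toSpanSingleton_apply] at hb
    have h1 : (p * (b * a) * p) • m = m := by
      rw [mul_smul, hpm, mul_smul, mul_smul, hb, hpm]
    rw [h b, zero_smul] at h1
    exact hm h1.symm

end CAR

lemma Qc_polar (n : ℕ) (x y : Fin n → ℂ) :
    QuadraticMap.polar (Qc n) x y = 2 * ∑ i, x i * y i := by
  simp only [QuadraticMap.polar, Qc, QuadraticMap.weightedSumSquares_apply, Pi.add_apply,
    Finset.mul_sum, ← Finset.sum_sub_distrib, one_smul]
  exact Finset.sum_congr rfl fun i _ => by ring

lemma Qc_sq (n : ℕ) (x : Fin n → ℂ) (h : ∑ i, x i * x i = 0) :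
    CliffordAlgebra.ι (Qc n) x * CliffordAlgebra.ι (Qc n) x = 0 := by
  rw [CliffordAlgebra.ι_sq_scalar, Qc, QuadraticMap.weightedSumSquares_apply]
  simp [h]

/-- Isotropic vectors. -/
noncomputable def isoVec (k : ℕ) (s : ℂ) (j : Fin k) : Fin (k + k) → ℂ :=
  Fin.append (Pi.single j (1 / 2)) (Pi.single j (s / 2))

lemma isoVec_dot (k : ℕ) (s t : ℂ) (i j : Fin k) :
    ∑ l, isoVec k s i l * isoVec k t j l = if i = j then (1 + s * t) / 4 else 0 := by
  simp only [isoVec, Fin.sum_univ_add, Fin.append_left, Fin.append_right]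
  by_cases h : i = j
  · subst h
    simp [Pi.single_apply]
    ring
  · simp [Pi.single_apply, h, Ne.symm h]

lemma isoVec_decomp (k : ℕ) (w : Fin (k + k) → ℂ) :
    w = ∑ j, ((w (Fin.castAdd k j) - Complex.I * w (Fin.natAdd k j)) • isoVec k Complex.I j +
      (w (Fin.castAdd k j) + Complex.I * w (Fin.natAdd k j)) • isoVec k (-Complex.I) j) := by
  have hI := Complex.I_mul_I
  funext l
  refine Fin.addCases (fun i => ?_) (fun i => ?_) l
  · simp [-Fin.natAdd_eq_addNat, isoVec, Finset.sum_apply, Pi.single_apply, Finset.sum_add_distrib]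
    ring
  · simp [-Fin.natAdd_eq_addNat, isoVec, Finset.sum_apply, Pi.single_apply, Finset.sum_add_distrib]
    linear_combination (w (Fin.natAdd k i)) * hI

/-- For even `n`, any two simple modules over `ℂCl(n)` are isomorphic. -/
theorem complex_clifford_simple_module_unique (n : ℕ) (hn : Even n)
    (M N : Type) [AddCommGroup M] [Module (ComplexCliffordAlgebra n) M]
    [AddCommGroup N] [Module (ComplexCliffordAlgebra n) N]
    (hM : IsSimpleModule (ComplexCliffordAlgebra n) M)
    (hN : IsSimpleModule (ComplexCliffordAlgebra n) N) :
    Nonempty (M ≃ₗ[ComplexCliffordAlgebra n] N) := by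
  obtain ⟨k, rfl⟩ := hn
  have hI := Complex.I_mul_I
  obtain ⟨p, hp, hvac⟩ := car_exists (A := ComplexCliffordAlgebra (k + k))
    (fun j => CliffordAlgebra.ι (Qc (k + k)) (isoVec k Complex.I j))
    (fun j => CliffordAlgebra.ι (Qc (k + k)) (isoVec k (-Complex.I) j))
    (fun i j => by
      rw [CliffordAlgebra.ι_mul_ι_add_swap, Qc_polar, isoVec_dot]
      simp)
    (fun i j => by
      rw [CliffordAlgebra.ι_mul_ι_add_swap, Qc_polar, isoVec_dot]
      simp)
    (fun i j => by
      rw [CliffordAlgebra.ι_mul_ι_add_swap, Qc_polar, isoVec_dot]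
      split_ifs
      · have h1 : (2 : ℂ) * ((1 + Complex.I * -Complex.I) / 4) = 1 := by
          linear_combination (-1 / 2) * hI
        rw [h1, map_one]
      · simp)
    (fun i => Qc_sq _ _ (by rw [isoVec_dot]; simp))
    (fun i => Qc_sq _ _ (by rw [isoVec_dot]; simp))
    (by
      intro T h1 hu hv
      rw [eq_top_iff]
      intro a _
      induction a using CliffordAlgebra.left_induction with
      | algebraMap r => rw [Algebra.algebraMap_eq_smul_one]; exact T.smul_mem r h1
      | add x y hx hy => exact add_mem (hx trivial) (hy trivial)
      | ι_mul x w hx =>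
        rw [isoVec_decomp k w, map_sum, Finset.sum_mul]
        refine sum_mem fun j _ => ?_
        rw [map_add, map_smul, map_smul, add_mul, smul_mul_assoc, smul_mul_assoc]
        exact add_mem (T.smul_mem _ (hu j _ (hx trivial))) (T.smul_mem _ (hv j _ (hx trivial))))
  obtain ⟨m, hm, hpm⟩ := hvac M (IsSimpleModule.nontrivial (ComplexCliffordAlgebra (k + k)) M)
  obtain ⟨m', hm', hpm'⟩ := hvac N (IsSimpleModule.nontrivial (ComplexCliffordAlgebra (k + k)) N)
  have hker : LinearMap.ker (LinearMap.toSpanSingleton (ComplexCliffordAlgebra (k + k)) M m) =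
      LinearMap.ker (LinearMap.toSpanSingleton (ComplexCliffordAlgebra (k + k)) N m') := by
    ext a
    rw [car_ker p hp M m hm hpm, car_ker p hp N m' hm' hpm']
  exact ⟨(LinearMap.quotKerEquivOfSurjective _
      (IsSimpleModule.toSpanSingleton_surjective _ hm)).symm.trans
    ((Submodule.quotEquivOfEq _ _ hker).trans (LinearMap.quotKerEquivOfSurjective _
      (IsSimpleModule.toSpanSingleton_surjective _ hm')))⟩
end

section
/- The real Clifford algebras C(1,3), C(4,0) and C(0,4) are all isomorphic as rings to the algebra Mat(2, ℍ) of 2×2 matrices over the real quaternions. -/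
open Matrix

set_option linter.all false
set_option linter.unusedSimpArgs false

/-- The real algebra of `2 × 2` quaternionic matrices. -/
abbrev MatQ := Matrix (Fin 2) (Fin 2) (Quaternion ℝ)

/-- The quaternion `a + b i + c j + d k`. -/
def qq (a b c d : ℝ) : Quaternion ℝ := ⟨a, b, c, d⟩

@[simp] theorem qq_re (a b c d : ℝ) : (qq a b c d).re = a := rfl
@[simp] theorem qq_imI (a b c d : ℝ) : (qq a b c d).imI = b := rfl
@[simp] theorem qq_imJ (a b c d : ℝ) : (qq a b c d).imJ = c := rfl
@[simp] theorem qq_imK (a b c d : ℝ) : (qq a b c d).imK = d := rfl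

@[simp] theorem one_re' : (1 : Quaternion ℝ).re = 1 := rfl
@[simp] theorem one_imI' : (1 : Quaternion ℝ).imI = 0 := rfl
@[simp] theorem one_imJ' : (1 : Quaternion ℝ).imJ = 0 := rfl
@[simp] theorem one_imK' : (1 : Quaternion ℝ).imK = 0 := rfl
@[simp] theorem zero_re' : (0 : Quaternion ℝ).re = 0 := rfl
@[simp] theorem zero_imI' : (0 : Quaternion ℝ).imI = 0 := rfl
@[simp] theorem zero_imJ' : (0 : Quaternion ℝ).imJ = 0 := rfl
@[simp] theorem zero_imK' : (0 : Quaternion ℝ).imK = 0 := rfl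

theorem matQ_ext {M N : MatQ} (h1 : M 0 0 = N 0 0) (h2 : M 0 1 = N 0 1) (h3 : M 1 0 = N 1 0)
    (h4 : M 1 1 = N 1 1) : M = N := by
  ext1 i j
  fin_cases i <;> fin_cases j <;> assumption

theorem matQ_top (S : Subalgebra ℝ MatQ)
    (hI : (!![(qq (0) (1) (0) (0)), 0; 0, (qq (0) (1) (0) (0))] : MatQ) ∈ S)
    (hJ : (!![(qq (0) (0) (1) (0)), 0; 0, (qq (0) (0) (1) (0))] : MatQ) ∈ S)
    (hE : (!![1, 0; 0, -1] : MatQ) ∈ S)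
    (hX : (!![0, 1; 1, 0] : MatQ) ∈ S) : S = ⊤ := by
  have hD : ∀ q : Quaternion ℝ, (!![q, 0; 0, q] : MatQ) ∈ S := by
    intro q
    have h : (!![q, 0; 0, q] : MatQ) = q.re • (1 : MatQ)
        + q.imI • (!![(qq (0) (1) (0) (0)), 0; 0, (qq (0) (1) (0) (0))] : MatQ)
        + q.imJ • (!![(qq (0) (0) (1) (0)), 0; 0, (qq (0) (0) (1) (0))] : MatQ)
        + q.imK • ((!![(qq (0) (1) (0) (0)), 0; 0, (qq (0) (1) (0) (0))] : MatQ) *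
          (!![(qq (0) (0) (1) (0)), 0; 0, (qq (0) (0) (1) (0))] : MatQ)) := by
      apply matQ_ext <;> apply Quaternion.ext <;>
      simp [-Matrix.cons_mul, Matrix.mul_apply, Fin.sum_univ_two]
    rw [h]
    exact S.add_mem (S.add_mem (S.add_mem (S.smul_mem S.one_mem _) (S.smul_mem hI _))
      (S.smul_mem hJ _)) (S.smul_mem (S.mul_mem hI hJ) _)
  have hE0 : (!![1, 0; 0, 0] : MatQ) ∈ S := by
    have h : (!![1, 0; 0, 0] : MatQ) = (1/2 : ℝ) • (1 + (!![1, 0; 0, -1] : MatQ)) := by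
      apply matQ_ext <;> apply Quaternion.ext <;>
      simp [-Matrix.cons_mul, Matrix.mul_apply, Fin.sum_univ_two] <;> norm_num
    rw [h]
    exact S.smul_mem (S.add_mem S.one_mem hE) _
  rw [eq_top_iff]
  intro M _
  have h : M = !![M 0 0, 0; 0, M 0 0] * !![1, 0; 0, 0]
      + !![M 0 1, 0; 0, M 0 1] * (!![1, 0; 0, 0] * !![0, 1; 1, 0])
      + !![M 1 0, 0; 0, M 1 0] * (!![0, 1; 1, 0] * !![1, 0; 0, 0])
      + !![M 1 1, 0; 0, M 1 1] * (!![0, 1; 1, 0] * !![1, 0; 0, 0] * !![0, 1; 1, 0]) := by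
    apply matQ_ext <;> apply Quaternion.ext <;>
      simp [-Matrix.cons_mul, Matrix.mul_apply, Fin.sum_univ_two]
  rw [h]
  exact S.add_mem (S.add_mem (S.add_mem (S.mul_mem (hD _) hE0)
    (S.mul_mem (hD _) (S.mul_mem hE0 hX))) (S.mul_mem (hD _) (S.mul_mem hX hE0)))
    (S.mul_mem (hD _) (S.mul_mem (S.mul_mem hX hE0) hX))

theorem clifford_iso_of_range (Q : QuadraticForm ℝ (Fin 4 → ℝ)) (f : (Fin 4 → ℝ) →ₗ[ℝ] MatQ)
    (hf : ∀ m, f m * f m = algebraMap ℝ MatQ (Q m))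
    (hS : ∀ S : Subalgebra ℝ MatQ, (∀ v, f v ∈ S) → S = ⊤) :
    Nonempty (CliffordAlgebra Q ≃+* MatQ) := by
  let φ := CliffordAlgebra.lift Q ⟨f, hf⟩
  have hφ : Function.Surjective φ := by
    rw [← AlgHom.range_eq_top]
    exact hS _ fun v => ⟨CliffordAlgebra.ι Q v, CliffordAlgebra.lift_ι_apply _ _ _⟩
  let e := CliffordAlgebra.equivExterior Q
  let b := ((Pi.basisFun ℝ (Fin 4)).ExteriorAlgebra).map e.symm
  have : Module.Finite ℝ (CliffordAlgebra Q) := Module.Finite.of_basis b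
  have h1 : Module.finrank ℝ (CliffordAlgebra Q) = 16 := by
    rw [Module.finrank_eq_card_basis b]; simp
  have h2 : Module.finrank ℝ MatQ = 16 := by
    rw [Module.finrank_matrix, Quaternion.finrank_eq_four]; simp
  have hinj : Function.Injective φ :=
    (LinearMap.injective_iff_surjective_of_finrank_eq_finrank (f := φ.toLinearMap)
      (h1.trans h2.symm)).2 hφ
  exact ⟨RingEquiv.ofBijective φ ⟨hinj, hφ⟩⟩

/-- The generators of `C(1,3)`. -/
noncomputable def f13 : (Fin 4 → ℝ) →ₗ[ℝ] MatQ where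
  toFun v := !![(qq (v 0) (0) (0) (0)), (qq (v 1) (v 2) (v 3) (0)); (qq (-v 1) (v 2) (v 3) (0)), (qq (-v 0) (0) (0) (0))]
  map_add' x y := by
    apply matQ_ext <;> apply Quaternion.ext <;>
      simp [-Matrix.cons_mul, Matrix.mul_apply, Fin.sum_univ_two, add_comm]
  map_smul' r x := by
    apply matQ_ext <;> apply Quaternion.ext <;>
      simp [-Matrix.cons_mul, Matrix.mul_apply, Fin.sum_univ_two]

/-- The generators of `C(4,0)` (`s = 1`) and `C(0,4)` (`s = -1`). -/
noncomputable def f40 (s : ℝ) : (Fin 4 → ℝ) →ₗ[ℝ] MatQ where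
  toFun v := !![0, (qq (v 0) (v 1) (v 2) (v 3)); (qq (s * v 0) (-(s * v 1)) (-(s * v 2)) (-(s * v 3))), 0]
  map_add' x y := by
    apply matQ_ext <;> apply Quaternion.ext <;>
      simp [-Matrix.cons_mul, Matrix.mul_apply, Fin.sum_univ_two] <;> ring
  map_smul' r x := by
    apply matQ_ext <;> apply Quaternion.ext <;>
      simp [-Matrix.cons_mul, Matrix.mul_apply, Fin.sum_univ_two] <;> ring

theorem f40_gen (s : ℝ) (hs : s * s = 1) (S : Subalgebra ℝ MatQ) (h : ∀ v, f40 s v ∈ S) :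
    S = ⊤ := by
  have h1 := S.mul_mem (h ![1,0,0,0]) (h ![0,1,0,0])
  have h2 := S.mul_mem (h ![1,0,0,0]) (h ![0,0,1,0])
  have h3 := S.mul_mem (h ![1,0,0,0]) (h ![0,0,0,1])
  have hI : (!![(qq (0) (1) (0) (0)), 0; 0, (qq (0) (1) (0) (0))] : MatQ) ∈ S := by
    convert S.mul_mem h2 h3 using 1
    apply matQ_ext <;> apply Quaternion.ext <;>
      simp [-Matrix.cons_mul, Matrix.mul_apply, Fin.sum_univ_two, f40, hs]
  have hJ : (!![(qq (0) (0) (1) (0)), 0; 0, (qq (0) (0) (1) (0))] : MatQ) ∈ S := by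
    convert S.mul_mem h3 h1 using 1
    apply matQ_ext <;> apply Quaternion.ext <;>
      simp [-Matrix.cons_mul, Matrix.mul_apply, Fin.sum_univ_two, f40, hs]
  have hE : (!![1, 0; 0, -1] : MatQ) ∈ S := by
    convert S.smul_mem (S.mul_mem h1 hI) s using 1
    apply matQ_ext <;> apply Quaternion.ext <;>
      simp [-Matrix.cons_mul, Matrix.mul_apply, Fin.sum_univ_two, f40, hs]
  refine matQ_top S hI hJ hE ?_
  convert S.add_mem (S.smul_mem (h ![1,0,0,0]) ((1 + s) / 2))
    (S.smul_mem (S.mul_mem hE (h ![1,0,0,0])) ((1 - s) / 2)) using 1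
  apply matQ_ext <;> apply Quaternion.ext <;>
      simp [-Matrix.cons_mul, Matrix.mul_apply, Fin.sum_univ_two, f40] <;> linarith

theorem f13_gen (S : Subalgebra ℝ MatQ) (h : ∀ v, f13 v ∈ S) : S = ⊤ := by
  have hX : (!![0, 1; 1, 0] : MatQ) ∈ S := by
    convert S.mul_mem (h ![1,0,0,0]) (h ![0,1,0,0]) using 1
    apply matQ_ext <;> apply Quaternion.ext <;>
      simp [-Matrix.cons_mul, Matrix.mul_apply, Fin.sum_univ_two, f13]
  refine matQ_top S ?_ ?_ ?_ hX
  · convert S.mul_mem hX (h ![0,0,1,0]) using 1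
    apply matQ_ext <;> apply Quaternion.ext <;>
      simp [-Matrix.cons_mul, Matrix.mul_apply, Fin.sum_univ_two, f13]
  · convert S.mul_mem hX (h ![0,0,0,1]) using 1
    apply matQ_ext <;> apply Quaternion.ext <;>
      simp [-Matrix.cons_mul, Matrix.mul_apply, Fin.sum_univ_two, f13]
  · convert h ![1,0,0,0] using 1
    apply matQ_ext <;> apply Quaternion.ext <;>
      simp [-Matrix.cons_mul, Matrix.mul_apply, Fin.sum_univ_two, f13]

/-- `C(1,3)`, `C(4,0)` and `C(0,4)` are all ring-isomorphic to `Mat(2, ℍ)`. -/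
theorem clifford_one_three_iso_matrix_quaternion :
    Nonempty (RealCliffordAlgebra 1 3 ≃+* Matrix (Fin 2) (Fin 2) (Quaternion ℝ)) ∧
    Nonempty (RealCliffordAlgebra 4 0 ≃+* Matrix (Fin 2) (Fin 2) (Quaternion ℝ)) ∧
    Nonempty (RealCliffordAlgebra 0 4 ≃+* Matrix (Fin 2) (Fin 2) (Quaternion ℝ)) := by
  refine ⟨clifford_iso_of_range (Qpq 1 3) f13 ?_ f13_gen,
    clifford_iso_of_range (Qpq 4 0) (f40 1) ?_ (f40_gen 1 (by norm_num)),
    clifford_iso_of_range (Qpq 0 4) (f40 (-1)) ?_ (f40_gen (-1) (by norm_num))⟩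
  · intro m
    have hQ : Qpq 1 3 m = m 0 * m 0 - m 1 * m 1 - m 2 * m 2 - m 3 * m 3 := by
      simp [Qpq, QuadraticMap.weightedSumSquares_apply, Fin.sum_univ_four]; ring
    rw [hQ]
    apply matQ_ext <;> apply Quaternion.ext <;>
      simp [-Matrix.cons_mul, Matrix.mul_apply, Fin.sum_univ_two, f13, Matrix.algebraMap_matrix_apply] <;> ring
  · intro m
    have hQ : Qpq 4 0 m = m 0 * m 0 + m 1 * m 1 + m 2 * m 2 + m 3 * m 3 := by
      simp [Qpq, QuadraticMap.weightedSumSquares_apply, Fin.sum_univ_four]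
    rw [hQ]
    apply matQ_ext <;> apply Quaternion.ext <;>
      simp [-Matrix.cons_mul, Matrix.mul_apply, Fin.sum_univ_two, f40, Matrix.algebraMap_matrix_apply] <;> ring
  · intro m
    have hQ : Qpq 0 4 m = - (m 0 * m 0) - m 1 * m 1 - m 2 * m 2 - m 3 * m 3 := by
      simp [Qpq, QuadraticMap.weightedSumSquares_apply, Fin.sum_univ_four]; ring
    rw [hQ]
    apply matQ_ext <;> apply Quaternion.ext <;>
      simp [-Matrix.cons_mul, Matrix.mul_apply, Fin.sum_univ_two, f40, Matrix.algebraMap_matrix_apply] <;> ring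
end

section
/- The real Clifford algebra C(1,3) and the real Clifford algebra C(3,1) are not isomorphic as rings: there is no ring isomorphism between C(1,3) and C(3,1). -/
open Quaternion in
/-- Quaternion with given coordinates. -/
noncomputable def quat (a b c d : ℝ) : ℍ[ℝ] := ⟨a, b, c, d⟩

@[simp] theorem quat_re (a b c d : ℝ) : (quat a b c d).re = a := rfl

@[simp] theorem quat_imI (a b c d : ℝ) : (quat a b c d).imI = b := rfl

@[simp] theorem quat_imJ (a b c d : ℝ) : (quat a b c d).imJ = c := rfl

@[simp] theorem quat_imK (a b c d : ℝ) : (quat a b c d).imK = d := rfl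

open Quaternion in
/-- The gamma-matrix map `ℝ^4 → M₂(ℍ)`. -/
noncomputable def gammaMap : (Fin (1 + 3) → ℝ) →ₗ[ℝ] Matrix (Fin 2) (Fin 2) ℍ[ℝ] where
  toFun x := !![quat 0 (x 1) (x 2) (x 3), quat (x 0) 0 0 0;
    quat (x 0) 0 0 0, quat 0 (-x 1) (-x 2) (-x 3)]
  map_add' x y := by
    ext i j <;> fin_cases i <;> fin_cases j <;> simp [add_comm]
  map_smul' r x := by
    ext i j <;> fin_cases i <;> fin_cases j <;> simp

theorem gammaMap_sq (x : Fin (1 + 3) → ℝ) :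
    gammaMap x * gammaMap x = algebraMap ℝ _ (Qpq 1 3 x) := by
  have hQ : Qpq 1 3 x = x 0 * x 0 - x 1 * x 1 - x 2 * x 2 - x 3 * x 3 := by
    simp [Qpq, QuadraticMap.weightedSumSquares_apply, Fin.sum_univ_succ]
    ring_nf
  rw [hQ, Matrix.algebraMap_eq_diagonal]
  ext i j <;> fin_cases i <;> fin_cases j <;>
    simp [gammaMap, Matrix.mul_apply, Fin.sum_univ_two] <;>
    first | ring1 | (ring_nf; rfl)

theorem gamma_relations {R : Type*} [Ring R] (a b c d : R)
    (h1 : b * b = 1) (h2 : c * c = 1) (h3 : d * d = -1)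
    (c01 : a * b = -(b * a)) (c02 : a * c = -(c * a)) (c03 : a * d = -(d * a))
    (c12 : b * c = -(c * b)) (c13 : b * d = -(d * b)) (c23 : c * d = -(d * c)) :
    (b * d) * (b * d) = 1 ∧ (b * c) * (b * c) = -1 ∧ a * (b * d) = (b * d) * a ∧
    c * a = -(a * c) ∧ c * (b * d) = (b * d) * c ∧ (b * c) * a = a * (b * c) ∧
    (b * c) * (b * d) = -((b * d) * (b * c)) := by
  have e : ∀ {x y u : R}, x * y = u → ∀ z, x * (y * z) = u * z := by
    intro x y u h z
    rw [← mul_assoc, h]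
  refine ⟨?_, ?_, ?_, ?_, ?_, ?_, ?_⟩ <;>
    simp only [mul_assoc, h1, h2, h3, c01, c02, c03, c12, c13, c23, e h1, e h2, e h3, e c01,
      e c02, e c03, e c12, e c13, e c23, neg_mul, mul_neg, neg_neg, one_mul, mul_one]

open Quaternion Matrix in
/-- There are no four such matrices in `M₂(ℍ)`. -/
theorem no_gamma (E : Fin 4 → Matrix (Fin 2) (Fin 2) ℍ[ℝ])
    (h0 : E 0 * E 0 = 1) (h1 : E 1 * E 1 = 1) (h2 : E 2 * E 2 = 1) (h3 : E 3 * E 3 = -1)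
    (hc : ∀ i j, i ≠ j → E i * E j = -(E j * E i)) : False := by
  obtain ⟨A, hA⟩ : ∃ A, A = E 0 := ⟨_, rfl⟩
  obtain ⟨B, hB⟩ : ∃ B, B = E 1 * E 3 := ⟨_, rfl⟩
  obtain ⟨U, hU⟩ : ∃ U, U = E 2 := ⟨_, rfl⟩
  obtain ⟨V, hV⟩ : ∃ V, V = E 1 * E 2 := ⟨_, rfl⟩
  have c01 := hc 0 1 (by decide)
  have c02 := hc 0 2 (by decide)
  have c03 := hc 0 3 (by decide)
  have c12 := hc 1 2 (by decide)
  have c13 := hc 1 3 (by decide)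
  have c23 := hc 2 3 (by decide)
  have AA : A * A = 1 := by rw [hA, h0]
  obtain ⟨BB, VV, AB, UA, UB, VA, VB⟩ :=
    gamma_relations (E 0) (E 1) (E 2) (E 3) h1 h2 h3 c01 c02 c03 c12 c13 c23
  rw [← hB] at BB AB UB VB
  rw [← hV] at VV VA VB
  rw [← hA] at AB UA VA
  rw [← hU] at UA UB
  have UU : U * U = 1 := by rw [hU, h2]
  clear hA hB hU hV
  have hUn : ∀ w : Fin 2 → ℍ[ℝ], w ᵥ* U = 0 → w = 0 := fun w h => by
    have := congrArg (· ᵥ* U) h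
    simpa [UU] using this
  have hVn : ∀ w : Fin 2 → ℍ[ℝ], w ᵥ* V = 0 → w = 0 := fun w h => by
    have := congrArg (· ᵥ* V) h
    simp only [vecMul_vecMul, zero_vecMul] at this
    rw [VV, vecMul_neg, vecMul_one] at this
    exact neg_eq_zero.mp this
  obtain ⟨w, hw, wA⟩ : ∃ w : Fin 2 → ℍ[ℝ], w ≠ 0 ∧ w ᵥ* A = w := by
    obtain ⟨e, he⟩ := exists_ne (0 : Fin 2 → ℍ[ℝ])
    by_cases h : e ᵥ* A + e = 0
    · refine ⟨e ᵥ* U, fun h' => he (hUn _ h'), ?_⟩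
      rw [vecMul_vecMul, UA, vecMul_neg, ← vecMul_vecMul, eq_neg_of_add_eq_zero_left h,
        neg_vecMul, neg_neg]
    · exact ⟨_, h, by rw [add_vecMul, vecMul_vecMul, AA, vecMul_one, add_comm]⟩
  obtain ⟨w, hw, wA, wB⟩ : ∃ w : Fin 2 → ℍ[ℝ], w ≠ 0 ∧ w ᵥ* A = w ∧ w ᵥ* B = w := by
    by_cases h : w ᵥ* B + w = 0
    · refine ⟨w ᵥ* V, fun h' => hw (hVn _ h'), ?_, ?_⟩
      · rw [vecMul_vecMul, VA, ← vecMul_vecMul, wA]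
      rw [vecMul_vecMul, VB, vecMul_neg, ← vecMul_vecMul, eq_neg_of_add_eq_zero_left h,
        neg_vecMul, neg_neg]
    · refine ⟨_, h, ?_, by rw [add_vecMul, vecMul_vecMul, BB, vecMul_one, add_comm]⟩
      rw [add_vecMul, vecMul_vecMul, ← AB, ← vecMul_vecMul, wA]
  have xA : (w ᵥ* U) ᵥ* A = -(w ᵥ* U) := by
    rw [vecMul_vecMul, UA, vecMul_neg, ← vecMul_vecMul, wA]
  have yA : (w ᵥ* V) ᵥ* A = w ᵥ* V := by
    rw [vecMul_vecMul, VA, ← vecMul_vecMul, wA]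
  have yB : (w ᵥ* V) ᵥ* B = -(w ᵥ* V) := by
    rw [vecMul_vecMul, VB, vecMul_neg, ← vecMul_vecMul, wB]
  have hx : w ᵥ* U ≠ 0 := fun h => hw (hUn _ h)
  have hy : w ᵥ* V ≠ 0 := fun h => hw (hVn _ h)
  generalize w ᵥ* U = x at *
  generalize w ᵥ* V = y at *
  have tw : ∀ z : Fin 2 → ℍ[ℝ], z + z = 0 → z = 0 := fun z hz => by
    rw [← two_smul ℝ] at hz
    exact (smul_eq_zero.mp hz).resolve_left (by norm_num)
  have li : LinearIndependent ℍ[ℝ] ![w, x, y] := by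
    rw [Fintype.linearIndependent_iff]
    intro g hg
    simp only [Fin.sum_univ_three, cons_val_zero, cons_val_one, cons_val] at hg
    have e1 := congrArg (· ᵥ* A) hg
    simp only [add_vecMul, smul_vecMul, wA, xA, yA, zero_vecMul, smul_neg] at e1
    have z1 : g 1 • x = 0 := tw _ (by
      rw [← sub_zero (_ + _), ← sub_self (0 : Fin 2 → ℍ[ℝ])]
      nth_rw 1 [← hg]
      rw [← e1]; abel)
    rw [z1, add_zero] at hg
    have e2 := congrArg (· ᵥ* B) hg
    simp only [add_vecMul, smul_vecMul, wB, yB, zero_vecMul, smul_neg] at e2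
    have z0 : g 0 • w = 0 := tw _ (by
      rw [← add_zero (0 : Fin 2 → ℍ[ℝ])]
      nth_rw 1 [← hg]
      rw [← e2]; abel)
    rw [z0, zero_add] at hg
    have r0 := (smul_eq_zero.mp z0).resolve_right hw
    have r1 := (smul_eq_zero.mp z1).resolve_right hx
    have r2 := (smul_eq_zero.mp hg).resolve_right hy
    intro i
    fin_cases i <;> assumption
  have := li.fintype_card_le_finrank
  simp at this

/-- Standard generators of `C(3,1)`. -/
noncomputable def gen31 (i : Fin 4) : RealCliffordAlgebra 3 1 :=
  CliffordAlgebra.ι (Qpq 3 1) (Pi.single i 1)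

theorem gen31_sq (i : Fin 4) : gen31 i * gen31 i = if (i : ℕ) < 3 then 1 else -1 := by
  rw [gen31, CliffordAlgebra.ι_sq_scalar]
  have : Qpq 3 1 (Pi.single i 1) = if (i : ℕ) < 3 then 1 else -1 := by
    rw [Qpq, QuadraticMap.weightedSumSquares_apply, Finset.sum_eq_single i]
    · simp
    · intro j _ hj
      simp [Pi.single_eq_of_ne hj]
    · simp
  rw [this]
  split_ifs <;> simp

theorem gen31_comm (i j : Fin 4) (h : i ≠ j) : gen31 i * gen31 j = -(gen31 j * gen31 i) := by
  refine CliffordAlgebra.ι_mul_ι_comm_of_isOrtho ?_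
  rw [QuadraticMap.isOrtho_def]
  simp only [Qpq, QuadraticMap.weightedSumSquares_apply]
  rw [← Finset.sum_add_distrib]
  refine Finset.sum_congr rfl fun k _ => ?_
  by_cases h1 : k = i
  · subst h1
    simp [Pi.single_eq_of_ne h]
  · simp [Pi.single_eq_of_ne h1]

/-- `C(1,3)` and `C(3,1)` are not isomorphic as rings. -/
theorem clifford_one_three_not_iso_three_one :
    IsEmpty (RealCliffordAlgebra 1 3 ≃+* RealCliffordAlgebra 3 1) := by
  refine ⟨fun f => ?_⟩
  let φ := (CliffordAlgebra.lift (Qpq 1 3) ⟨gammaMap, gammaMap_sq⟩).toRingHom.comp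
    f.symm.toRingHom
  refine no_gamma (fun i => φ (gen31 i)) ?_ ?_ ?_ ?_ ?_
  · rw [← map_mul, gen31_sq]; simp
  · rw [← map_mul, gen31_sq]; simp
  · rw [← map_mul, gen31_sq]; simp
  · rw [← map_mul, gen31_sq]; simp
  · intro i j h
    rw [← map_mul, gen31_comm i j h, map_neg, map_mul]
end
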